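/- Let P be either the south pole S or the north pole N. There does not exist a (−1)-homogeneous axisymmetric solution u ∈ C²(S² \ {P}) of the stationary Navier–Stokes equations satisfying 0 < limsup_{x∈S², x→P} |u(x)|/|ln|x'|| < ∞. -/

import Mathlib

noncomputable section

open Real Filter MeasureTheory Metric Topology
open scoped ENNReal InnerProductSpace

abbrev V3 := EuclideanSpace ℝ (Fin 3)
abbrev V2 := EuclideanSpace ℝ (Fin 2)

/-- standard basis vector in `ℝ³` -/
def e3 (j : Fin 3) : V3 := EuclideanSpace.single j 1

/-- partial derivative `∂_j f` -/
def pd (j : Fin 3) (f : V3 → ℝ) (x : V3) : ℝ := fderiv ℝ f x (e3 j)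

/-- Laplacian on `ℝ³` -/
def lap3 (f : V3 → ℝ) (x : V3) : ℝ := ∑ j, pd j (fun y => pd j f y) x

/-- stationary Navier–Stokes equations `-Δu + (u·∇)u + ∇p = 0`, `div u = 0` at `x` -/
def NSEq (u : V3 → V3) (p : V3 → ℝ) (x : V3) : Prop :=
  (∀ i, - lap3 (fun z => u z i) x + (∑ j, u x j * pd j (fun z => u z i) x) + pd i p x = 0)
  ∧ (∑ j, pd j (fun z => u z j) x) = 0

/-- stationary Euler equations `(u·∇)u + ∇p = 0`, `div u = 0` at `x` -/
def EulerEq (u : V3 → V3) (p : V3 → ℝ) (x : V3) : Prop :=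
  (∀ i, (∑ j, u x j * pd j (fun z => u z i) x) + pd i p x = 0)
  ∧ (∑ j, pd j (fun z => u z j) x) = 0

/-- south pole -/
def S3 : V3 := EuclideanSpace.single 2 (-1)
/-- north pole -/
def N3 : V3 := EuclideanSpace.single 2 1

/-- the unit sphere `S²` -/
def sphere2 : Set V3 := Metric.sphere (0 : V3) 1

/-- the open cone over a subset of the unit sphere -/
def cone3 (Ω : Set V3) : Set V3 := {x : V3 | x ≠ 0 ∧ (‖x‖⁻¹ • x) ∈ Ω}

/-- `|x'| = √(x₁² + x₂²)` -/
def rho (x : V3) : ℝ := Real.sqrt ((x 0) ^ 2 + (x 1) ^ 2)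

/-- the `x₃`-axis `{x' = 0}` -/
def axis3 : Set V3 := {x : V3 | x 0 = 0 ∧ x 1 = 0}

/-- `Ω_{a,b,R} = {a < x₃ < b, |x'| < R}` -/
def OmegaR (a b R : ℝ) : Set V3 := {x : V3 | a < x 2 ∧ x 2 < b ∧ rho x < R}

/-- build a point of `ℝ³` from `x' ∈ ℝ²` and `x₃ ∈ ℝ` -/
def emb (y : V2) (t : ℝ) : V3 := (EuclideanSpace.equiv (Fin 3) ℝ).symm ![y 0, y 1, t]

/-- spherical component `u_r = u · e_r` -/
def uRc (u : V3 → V3) (x : V3) : ℝ := (u x 0 * x 0 + u x 1 * x 1 + u x 2 * x 2) / ‖x‖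

/-- spherical component `u_θ = u · e_θ` -/
def uTc (u : V3 → V3) (x : V3) : ℝ :=
  (u x 0 * x 0 * x 2 + u x 1 * x 1 * x 2) / (‖x‖ * rho x) - u x 2 * rho x / ‖x‖

/-- spherical component `u_φ = u · e_φ` -/
def uPc (u : V3 → V3) (x : V3) : ℝ := (-(u x 0) * x 1 + u x 1 * x 0) / rho x

/-- axisymmetry on a set: the spherical components are independent of the meridian angle -/
def AxisymOn (u : V3 → V3) (Ω : Set V3) : Prop :=
  ∀ x ∈ Ω, ∀ y ∈ Ω, ‖x‖ = ‖y‖ → x 2 = y 2 →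
    uRc u x = uRc u y ∧ uTc u x = uTc u y ∧ uPc u x = uPc u y

/-- spherical frame vector `e_r` -/
def eRv (x : V3) : V3 := ‖x‖⁻¹ • x

/-- spherical frame vector `e_θ` -/
def eThv (x : V3) : V3 := (EuclideanSpace.equiv (Fin 3) ℝ).symm
  ![x 2 * x 0 / (‖x‖ * rho x), x 2 * x 1 / (‖x‖ * rho x), -(rho x) / ‖x‖]

/-- spherical frame vector `e_φ` -/
def ePhv (x : V3) : V3 := (EuclideanSpace.equiv (Fin 3) ℝ).symm ![-(x 1) / rho x, x 0 / rho x, 0]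

/-- the spherical cap `S² ∩ B_δ(S) \ {S}` -/
def NSCap (δ : ℝ) : Set V3 := (sphere2 ∩ Metric.ball S3 δ) \ {S3}

/-- the spherical cap `S² ∩ B_δ(S)` -/
def NSCapFull (δ : ℝ) : Set V3 := sphere2 ∩ Metric.ball S3 δ


lemma pd_congr {f g : V3 → ℝ} {x : V3} (j : Fin 3) (h : f =ᶠ[𝓝 x] g) : pd j f x = pd j g x := by
  unfold pd; rw [h.fderiv_eq]

lemma pd_congr' {f g : V3 → ℝ} {x : V3} (j : Fin 3) (h : f =ᶠ[𝓝 x] g) :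
    (fun y => pd j f y) =ᶠ[𝓝 x] (fun y => pd j g y) := by
  filter_upwards [h.eventuallyEq_nhds] with y hy using pd_congr j hy

lemma lap3_congr {f g : V3 → ℝ} {x : V3} (h : f =ᶠ[𝓝 x] g) : lap3 f x = lap3 g x := by
  unfold lap3
  exact Finset.sum_congr rfl fun j _ => pd_congr j (pd_congr' j h)

lemma pd_add {f g : V3 → ℝ} {x : V3} (j : Fin 3) (hf : DifferentiableAt ℝ f x)
    (hg : DifferentiableAt ℝ g x) : pd j (fun y => f y + g y) x = pd j f x + pd j g x := by
  unfold pd; rw [fderiv_fun_add hf hg]; rfl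

lemma pd_sub {f g : V3 → ℝ} {x : V3} (j : Fin 3) (hf : DifferentiableAt ℝ f x)
    (hg : DifferentiableAt ℝ g x) : pd j (fun y => f y - g y) x = pd j f x - pd j g x := by
  unfold pd; rw [fderiv_fun_sub hf hg]; rfl

lemma pd_mul {f g : V3 → ℝ} {x : V3} (j : Fin 3) (hf : DifferentiableAt ℝ f x)
    (hg : DifferentiableAt ℝ g x) :
    pd j (fun y => f y * g y) x = f x * pd j g x + g x * pd j f x := by
  unfold pd; rw [fderiv_fun_mul hf hg]; simp

lemma pd_comp {g : ℝ → ℝ} {g' : ℝ} {f : V3 → ℝ} {x : V3} (j : Fin 3)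
    (hg : HasDerivAt g g' (f x)) (hf : DifferentiableAt ℝ f x) :
    pd j (fun y => g (f y)) x = g' * pd j f x := by
  unfold pd
  have := (hg.comp_hasFDerivAt x hf.hasFDerivAt).fderiv
  simp only [Function.comp_def] at this
  rw [this]; simp

lemma cd_pd {f : V3 → ℝ} {x : V3} (j : Fin 3) (hf : ContDiffAt ℝ 2 f x) :
    DifferentiableAt ℝ (fun y => pd j f y) x := by
  have h : ContDiffAt ℝ 1 (fderiv ℝ f) x := hf.fderiv_right (by norm_num)
  have := h.differentiableAt (by norm_num)
  unfold pd
  exact this.clm_apply (differentiableAt_const _)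

lemma cd_d {E : Type*} [NormedAddCommGroup E] [NormedSpace ℝ E] {f : E → ℝ} {x : E}
    (hf : ContDiffAt ℝ 2 f x) :
    DifferentiableAt ℝ f x := hf.differentiableAt (by norm_num)

lemma cd_ev {f : V3 → ℝ} {x : V3} (hf : ContDiffAt ℝ 2 f x) :
    ∀ᶠ y in 𝓝 x, DifferentiableAt ℝ f y := by
  filter_upwards [hf.eventually (by simp)] with y hy using cd_d hy

lemma lap3_add {f g : V3 → ℝ} {x : V3} (hf : ContDiffAt ℝ 2 f x) (hg : ContDiffAt ℝ 2 g x) :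
    lap3 (fun y => f y + g y) x = lap3 f x + lap3 g x := by
  unfold lap3
  rw [← Finset.sum_add_distrib]
  refine Finset.sum_congr rfl fun j _ => ?_
  rw [← pd_add j (cd_pd j hf) (cd_pd j hg)]
  apply pd_congr
  filter_upwards [cd_ev hf, cd_ev hg] with y h1 h2 using pd_add j h1 h2

lemma lap3_sub {f g : V3 → ℝ} {x : V3} (hf : ContDiffAt ℝ 2 f x) (hg : ContDiffAt ℝ 2 g x) :
    lap3 (fun y => f y - g y) x = lap3 f x - lap3 g x := by
  unfold lap3
  rw [← Finset.sum_sub_distrib]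
  refine Finset.sum_congr rfl fun j _ => ?_
  rw [← pd_sub j (cd_pd j hf) (cd_pd j hg)]
  apply pd_congr
  filter_upwards [cd_ev hf, cd_ev hg] with y h1 h2 using pd_sub j h1 h2

lemma lap3_mul {f g : V3 → ℝ} {x : V3} (hf : ContDiffAt ℝ 2 f x) (hg : ContDiffAt ℝ 2 g x) :
    lap3 (fun y => f y * g y) x
      = f x * lap3 g x + 2 * (∑ j, pd j f x * pd j g x) + g x * lap3 f x := by
  unfold lap3
  rw [Finset.mul_sum, Finset.mul_sum, Finset.mul_sum, ← Finset.sum_add_distrib,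
    ← Finset.sum_add_distrib]
  refine Finset.sum_congr rfl fun j _ => ?_
  have : pd j (fun y => pd j (fun z => f z * g z) y) x
      = pd j (fun y => f y * pd j g y + g y * pd j f y) x := by
    apply pd_congr
    filter_upwards [cd_ev hf, cd_ev hg] with y h1 h2 using pd_mul j h1 h2
  rw [this, pd_add j ((cd_d hf).fun_mul (cd_pd j hg)) ((cd_d hg).fun_mul (cd_pd j hf)),
    pd_mul j (cd_d hf) (cd_pd j hg), pd_mul j (cd_d hg) (cd_pd j hf)]
  ring

lemma lap3_comp {g g' : ℝ → ℝ} {g'' : ℝ} {f : V3 → ℝ} {x : V3}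
    (hg : ∀ᶠ t in 𝓝 (f x), HasDerivAt g (g' t) t) (hg' : HasDerivAt g' g'' (f x))
    (hf : ContDiffAt ℝ 2 f x) :
    lap3 (fun y => g (f y)) x = g'' * (∑ j, pd j f x ^ 2) + g' (f x) * lap3 f x := by
  unfold lap3
  rw [Finset.mul_sum, Finset.mul_sum, ← Finset.sum_add_distrib]
  refine Finset.sum_congr rfl fun j _ => ?_
  have : pd j (fun y => pd j (fun z => g (f z)) y) x
      = pd j (fun y => g' (f y) * pd j f y) x := by
    apply pd_congr
    filter_upwards [cd_ev hf, hf.continuousAt.eventually hg] with y h1 h2 using pd_comp j h2 h1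
  have hd : DifferentiableAt ℝ (fun y => g' (f y)) x :=
    hg'.differentiableAt.comp x (cd_d hf)
  rw [this, pd_mul j hd (cd_pd j hf), pd_comp j hg' (cd_d hf)]
  ring

lemma cd_coord (i : Fin 3) (x : V3) : ContDiffAt ℝ 2 (fun y : V3 => y i) x := by
  fun_prop

lemma pd_coord (i j : Fin 3) (x : V3) : pd j (fun y : V3 => y i) x = if i = j then 1 else 0 := by
  unfold pd
  have : HasFDerivAt (fun y : V3 => y i) (EuclideanSpace.proj i : V3 →L[ℝ] ℝ) x :=
    (EuclideanSpace.proj i : V3 →L[ℝ] ℝ).hasFDerivAt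
  rw [this.fderiv]
  simp [e3]

lemma lap3_coord (i : Fin 3) (x : V3) : lap3 (fun y : V3 => y i) x = 0 := by
  unfold lap3
  refine Finset.sum_eq_zero fun j _ => ?_
  have : (fun y : V3 => pd j (fun z : V3 => z i) y) = fun _ => if i = j then 1 else 0 := by
    ext y; exact pd_coord i j y
  rw [this]; unfold pd; simp

def Rf (x : V3) : ℝ := ‖x‖⁻¹
def Yf (x : V3) : ℝ := x 2 * Rf x

lemma norm_sq3 (x : V3) : ‖x‖ ^ 2 = x 0 ^ 2 + x 1 ^ 2 + x 2 ^ 2 := by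
  rw [EuclideanSpace.norm_sq_eq]; simp [Fin.sum_univ_three]

lemma cd_R {x : V3} (hx : x ≠ 0) : ContDiffAt ℝ 2 Rf x := by
  unfold Rf
  exact (contDiffAt_norm ℝ hx).inv (norm_ne_zero_iff.2 hx)

lemma cd_Y {x : V3} (hx : x ≠ 0) : ContDiffAt ℝ 2 Yf x := (cd_coord 2 x).mul (cd_R hx)

lemma pd_R {x : V3} (hx : x ≠ 0) (j : Fin 3) : pd j Rf x = - x j * (Rf x) ^ 3 := by
  unfold pd
  have h0 := norm_ne_zero_iff.2 hx
  have h1 : HasFDerivAt (fun y : V3 => ‖y‖ ^ 2) (2 • innerSL ℝ x) x :=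
    (hasStrictFDerivAt_norm_sq x).hasFDerivAt
  have h2 : DifferentiableAt ℝ Rf x := cd_d (cd_R hx)
  have h3 : (fun y : V3 => Rf y ^ 2 * ‖y‖ ^ 2) =ᶠ[𝓝 x] fun _ => 1 := by
    filter_upwards [isOpen_ne.mem_nhds hx] with y hy
    have := norm_ne_zero_iff.2 hy
    unfold Rf; field_simp
  have h4 := (h2.hasFDerivAt.pow 2).mul h1
  have h5 := (h3.fderiv_eq (𝕜 := ℝ))
  have h6 : fderiv ℝ (fun y : V3 => Rf y ^ 2 * ‖y‖ ^ 2) x = _ := h4.fderiv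
  rw [h5] at h6
  have h7 := congrArg (fun L => L (e3 j)) h6
  have h8 : inner ℝ x (e3 j) = x j := by simp [e3, EuclideanSpace.inner_single_right]
  simp [h8] at h7
  have : Rf x * ‖x‖ = 1 := by unfold Rf; field_simp
  have hR : Rf x ≠ 0 := by intro h; simp [h] at this
  generalize (fderiv ℝ Rf x) (e3 j) = D at *
  generalize Rf x = R at *
  generalize ‖x‖ = r at *
  have e : R * (D * r ^ 2 + R * x j) = 0 := by linarith
  have e2 := (mul_eq_zero.1 e).resolve_left hR
  calc D = D * (R * r) ^ 2 := by rw [this]; ring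
    _ = R ^ 2 * (D * r ^ 2) := by ring
    _ = _ := by rw [show D * r^2 = - (R * x j) by linarith]; ring

lemma R_norm {x : V3} (hx : x ≠ 0) : Rf x ^ 2 * (x 0 ^ 2 + x 1 ^ 2 + x 2 ^ 2) = 1 := by
  rw [← norm_sq3]
  have h0 := norm_ne_zero_iff.2 hx
  unfold Rf; field_simp

lemma lap3_R {x : V3} (hx : x ≠ 0) : lap3 Rf x = 0 := by
  unfold lap3
  have key : ∀ j, pd j (fun y => pd j Rf y) x = - (Rf x) ^ 3 + 3 * x j ^ 2 * Rf x ^ 5 := by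
    intro j
    have : pd j (fun y => pd j Rf y) x = pd j (fun y => (0 - y j) * (Rf y) ^ 3) x := by
      apply pd_congr
      filter_upwards [isOpen_ne.mem_nhds hx] with y hy
      rw [pd_R hy]; ring
    have hR := cd_d (cd_R hx)
    have hc := cd_d (cd_coord j x)
    rw [this, pd_mul j ((differentiableAt_const _).fun_sub hc) (hR.fun_pow 3),
      pd_sub j (differentiableAt_const _) hc, pd_coord,
      pd_comp (g := fun t => t ^ 3) (g' := 3 * Rf x ^ 2) j (by simpa using hasDerivAt_pow 3 (Rf x)) hR,
      pd_R hx]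
    have : pd j (fun _ : V3 => (0:ℝ)) x = 0 := by unfold pd; simp
    rw [this]; simp; ring
  simp only [key, Fin.sum_univ_three]
  linear_combination 3 * Rf x ^ 3 * R_norm hx

lemma pd_Y {x : V3} (hx : x ≠ 0) (j : Fin 3) :
    pd j Yf x = x 2 * (- x j * (Rf x) ^ 3) + Rf x * (if (2:Fin 3) = j then 1 else 0) := by
  unfold Yf
  rw [pd_mul j (cd_d (cd_coord 2 x)) (cd_d (cd_R hx)), pd_coord, pd_R hx]

lemma lap3_Y {x : V3} (hx : x ≠ 0) : lap3 Yf x = - 2 * x 2 * Rf x ^ 3 := by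
  unfold Yf
  rw [lap3_mul (cd_coord 2 x) (cd_R hx), lap3_R hx, lap3_coord]
  simp only [Fin.sum_univ_three, pd_coord, pd_R hx]
  simp; ring

lemma grad_Y_sq {x : V3} (hx : x ≠ 0) : (∑ j, pd j Yf x ^ 2) = Rf x ^ 2 * (1 - Yf x ^ 2) := by
  simp only [Fin.sum_univ_three, pd_Y hx]
  simp
  unfold Yf
  linear_combination (x 2 ^ 2 * Rf x ^ 4) * R_norm hx

lemma grad_YR {x : V3} (hx : x ≠ 0) : (∑ j, pd j Yf x * pd j Rf x) = 0 := by
  simp only [Fin.sum_univ_three, pd_Y hx, pd_R hx]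
  simp
  linear_combination (x 2 * Rf x ^ 4) * R_norm hx

def Off : Set V3 := {x : V3 | ¬ (x 0 = 0 ∧ x 1 = 0)}

lemma Off_open : IsOpen Off := by
  have : IsClosed {x : V3 | x 0 = 0 ∧ x 1 = 0} := by
    apply IsClosed.and
    · exact isClosed_eq (by fun_prop) (by fun_prop)
    · exact isClosed_eq (by fun_prop) (by fun_prop)
  exact this.isOpen_compl

lemma Off_ne {x : V3} (hx : x ∈ Off) : x ≠ 0 := by
  rintro rfl; exact hx (by simp)

structure Sol (u : V3 → V3) (p : V3 → ℝ) : Prop where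
  hu : ∀ x ∈ Off, ∀ lam : ℝ, 0 < lam → u (lam • x) = lam⁻¹ • u x
  hp : ∀ x ∈ Off, ∀ lam : ℝ, 0 < lam → p (lam • x) = (lam ^ 2)⁻¹ * p x
  cu : ContDiffOn ℝ 2 u Off
  cp : ContDiffOn ℝ 1 p Off
  ax : AxisymOn u Off
  ns : ∀ x ∈ Off, NSEq u p x

def qv (y : ℝ) : V3 := !₂[√(1 - y ^ 2), 0, y]

@[simp] lemma qv0 (y : ℝ) : qv y 0 = √(1 - y ^ 2) := rfl
@[simp] lemma qv1 (y : ℝ) : qv y 1 = 0 := rfl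
@[simp] lemma qv2 (y : ℝ) : qv y 2 = y := rfl

lemma s2_pos {y : ℝ} (hy : y ∈ Set.Ioo (-1:ℝ) 1) : 0 < 1 - y ^ 2 := by
  nlinarith [hy.1, hy.2]

lemma s_pos {y : ℝ} (hy : y ∈ Set.Ioo (-1:ℝ) 1) : 0 < √(1 - y ^ 2) := Real.sqrt_pos.2 (s2_pos hy)
lemma s_sq {y : ℝ} (hy : y ∈ Set.Ioo (-1:ℝ) 1) : √(1 - y ^ 2) ^ 2 = 1 - y ^ 2 :=
  Real.sq_sqrt (s2_pos hy).le

lemma qv_off {y : ℝ} (hy : y ∈ Set.Ioo (-1:ℝ) 1) : qv y ∈ Off := fun h => (s_pos hy).ne' h.1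

lemma qv_norm {y : ℝ} (hy : y ∈ Set.Ioo (-1:ℝ) 1) : ‖qv y‖ = 1 := by
  have : ‖qv y‖ ^ 2 = 1 := by rw [norm_sq3]; simp [s_sq hy]
  have h := norm_nonneg (qv y)
  nlinarith

lemma Y_mem {x : V3} (hx : x ∈ Off) : Yf x ∈ Set.Ioo (-1:ℝ) 1 := by
  have h := R_norm (Off_ne hx)
  have hR : 0 < Rf x := inv_pos.2 (norm_pos_iff.2 (Off_ne hx))
  have : 0 < x 0 ^ 2 + x 1 ^ 2 := by
    by_contra hc
    exact hx ⟨by nlinarith [sq_nonneg (x 0), sq_nonneg (x 1)],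
      by nlinarith [sq_nonneg (x 0), sq_nonneg (x 1)]⟩
  have h2 : Yf x ^ 2 < 1 := by
    have : 0 < Rf x ^ 2 * (x 0 ^ 2 + x 1 ^ 2) := by positivity
    unfold Yf; nlinarith
  exact abs_lt.1 ((sq_lt_one_iff_abs_lt_one _).1 h2)

def Fq (u : V3 → V3) (y : ℝ) : ℝ := √(1 - y ^ 2) * u (qv y) 0 + y * u (qv y) 2
def Wq (u : V3 → V3) (y : ℝ) : ℝ := u (qv y) 2
def Vq (u : V3 → V3) (y : ℝ) : ℝ := √(1 - y ^ 2) * u (qv y) 1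
def Pq (p : V3 → ℝ) (y : ℝ) : ℝ := p (qv y)

lemma rho_pos {x : V3} (hx : x ∈ Off) : 0 < rho x := by
  unfold rho
  apply Real.sqrt_pos.2
  by_contra hc
  exact hx ⟨by nlinarith [sq_nonneg (x 0), sq_nonneg (x 1)],
      by nlinarith [sq_nonneg (x 0), sq_nonneg (x 1)]⟩

lemma rep {u : V3 → V3} {p : V3 → ℝ} (h : Sol u p) {x : V3} (hx : x ∈ Off) :
    x 0 * u x 0 + x 1 * u x 1 + x 2 * u x 2 = Fq u (Yf x) ∧ u x 2 = Wq u (Yf x) * Rf x ∧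
    x 0 * u x 1 - x 1 * u x 0 = Vq u (Yf x) := by
  have hy := Y_mem hx
  have hr : 0 < ‖x‖ := norm_pos_iff.2 (Off_ne hx)
  have hRr : Rf x * ‖x‖ = 1 := by unfold Rf; field_simp
  have hq := qv_off hy
  have hu := h.hu _ hq ‖x‖ hr
  set r := ‖x‖ with hrdef
  set y := Yf x with hydef
  have hyr : r * y = x 2 := by
    rw [hydef]; unfold Yf; linear_combination (x 2) * hRr
  have hz : r • qv y ∈ Off := by
    intro hc
    have := hc.1
    simp at this
    rcases this with h1 | h1
    · exact hr.ne' h1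
    · exact (s_pos hy).ne' h1
  have hzn : ‖r • qv y‖ = r := by
    rw [norm_smul, qv_norm hy]; simp [hrdef]
  have hs : 0 < r * √(1 - y ^ 2) := mul_pos hr (s_pos hy)
  have hrz : rho (r • qv y) = r * √(1 - y ^ 2) := by
    unfold rho; simp; exact Real.sqrt_sq hs.le
  have hn := norm_sq3 x
  have hrx : rho x = r * √(1 - y ^ 2) := by
    unfold rho
    rw [Real.sqrt_eq_iff_eq_sq (by positivity) hs.le, mul_pow, s_sq hy]
    rw [← hrdef] at hn
    linear_combination (-1 : ℝ) * hn + (r * y + x 2) * hyr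
  obtain ⟨e1, e2, e3⟩ := h.ax x hx _ hz (by rw [hzn]) (by simp [hyr])
  unfold uRc at e1
  unfold uTc at e2
  unfold uPc at e3
  rw [hu, hzn, ← hrdef] at e1
  rw [hu, hzn, hrz, hrx, ← hrdef] at e2
  rw [hu, hrz, hrx] at e3
  simp only [PiLp.smul_apply, smul_eq_mul, qv0, qv1, qv2] at e1 e2 e3
  have hss := s_sq hy
  set s := √(1 - y ^ 2)
  have hsp : 0 < s := s_pos hy
  unfold Fq Wq Vq
  have hR : Rf x = r⁻¹ := rfl
  rw [hR, show √(1 - y ^ 2) = s from rfl]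
  rw [← hyr] at e1 e2 ⊢
  field_simp at e1 e2 e3
  have h1 : x 0 * u x 0 + x 1 * u x 1 + r * y * u x 2 = s * u (qv y) 0 + y * u (qv y) 2 := by
    linear_combination e1
  have h3 : x 0 * u x 1 - x 1 * u x 0 = s * u (qv y) 1 := by
    linear_combination e3
  refine ⟨h1, ?_, h3⟩
  field_simp
  have h2 : (u x 0 * x 0 + u x 1 * x 1) * y - u x 2 * r * s ^ 2 = s * (u (qv y) 0 * y - u (qv y) 2 * s) := by
    linear_combination e2
  have : u x 2 * r = u (qv y) 2 := by
    linear_combination y * h1 - h2 + (u (qv y) 2 - u x 2 * r) * hss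
  linear_combination this

lemma u_cd {u : V3 → V3} {p : V3 → ℝ} (h : Sol u p) {x : V3} (hx : x ∈ Off) (i : Fin 3) :
    ContDiffAt ℝ 2 (fun z => u z i) x := by
  have := h.cu.contDiffAt (Off_open.mem_nhds hx)
  fun_prop

lemma p_cd {u : V3 → V3} {p : V3 → ℝ} (h : Sol u p) {x : V3} (hx : x ∈ Off) :
    DifferentiableAt ℝ p x :=
  (h.cp.contDiffAt (Off_open.mem_nhds hx)).differentiableAt (by norm_num)

lemma s_cd {y : ℝ} (hy : y ∈ Set.Ioo (-1:ℝ) 1) : ContDiffAt ℝ 2 (fun y : ℝ => √(1 - y ^ 2)) y :=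
  ContDiffAt.sqrt (by fun_prop) (s2_pos hy).ne'

lemma qv_cd {y : ℝ} (hy : y ∈ Set.Ioo (-1:ℝ) 1) : ContDiffAt ℝ 2 qv y := by
  rw [contDiffAt_euclidean]
  intro i
  fin_cases i
  · exact s_cd hy
  · exact contDiffAt_const
  · exact contDiffAt_id

lemma uq_cd {u : V3 → V3} {p : V3 → ℝ} (h : Sol u p) {y : ℝ} (hy : y ∈ Set.Ioo (-1:ℝ) 1)
    (i : Fin 3) : ContDiffAt ℝ 2 (fun y => u (qv y) i) y :=
  ContDiffAt.comp (g := fun z => u z i) y (u_cd h (qv_off hy) i) (qv_cd hy)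

lemma W_cd {u : V3 → V3} {p : V3 → ℝ} (h : Sol u p) {y : ℝ} (hy : y ∈ Set.Ioo (-1:ℝ) 1) :
    ContDiffAt ℝ 2 (Wq u) y := uq_cd h hy 2

lemma V_cd {u : V3 → V3} {p : V3 → ℝ} (h : Sol u p) {y : ℝ} (hy : y ∈ Set.Ioo (-1:ℝ) 1) :
    ContDiffAt ℝ 2 (Vq u) y := (s_cd hy).mul (uq_cd h hy 1)

lemma F_cd {u : V3 → V3} {p : V3 → ℝ} (h : Sol u p) {y : ℝ} (hy : y ∈ Set.Ioo (-1:ℝ) 1) :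
    ContDiffAt ℝ 2 (Fq u) y :=
  ((s_cd hy).mul (uq_cd h hy 0)).add (contDiffAt_id.mul (uq_cd h hy 2))

lemma cd1 {g : ℝ → ℝ} {y : ℝ} (hg : ContDiffAt ℝ 2 g y) : HasDerivAt g (deriv g y) y :=
  (cd_d hg).hasDerivAt

lemma cd1' {g : ℝ → ℝ} {y : ℝ} (hg : ContDiffAt ℝ 2 g y) :
    ∀ᶠ t in 𝓝 y, HasDerivAt g (deriv g t) t := by
  filter_upwards [hg.eventually (by simp)] with y hy using cd1 hy

lemma cd2 {g : ℝ → ℝ} {y : ℝ} (hg : ContDiffAt ℝ 2 g y) :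
    HasDerivAt (deriv g) (deriv (deriv g) y) y := by
  have h : ContDiffAt ℝ 1 (fderiv ℝ g) y := hg.fderiv_right (by norm_num)
  have h2 := (h.differentiableAt (by norm_num)).clm_apply (differentiableAt_const (1:ℝ))
  exact DifferentiableAt.hasDerivAt h2

lemma Rf_one {x : V3} (hx : ‖x‖ = 1) : Rf x = 1 := by simp [Rf, hx]
lemma Yf_one {x : V3} (hx : ‖x‖ = 1) : Yf x = x 2 := by simp [Yf, Rf_one hx]
lemma ne_one {x : V3} (hx : ‖x‖ = 1) : x ≠ 0 := by rintro rfl; simp at hx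

lemma pd_gY {g : ℝ → ℝ} {x : V3} (hx : ‖x‖ = 1) (hg : ContDiffAt ℝ 2 g (x 2)) (j : Fin 3) :
    pd j (fun z => g (Yf z)) x = deriv g (x 2) * ((if (2:Fin 3) = j then 1 else 0) - x 2 * x j) := by
  rw [← Yf_one hx] at hg
  rw [pd_comp j (cd1 hg) (cd_d (cd_Y (ne_one hx))), pd_Y (ne_one hx), Rf_one hx, Yf_one hx]
  ring

lemma lap3_gY {g : ℝ → ℝ} {x : V3} (hx : ‖x‖ = 1) (hg : ContDiffAt ℝ 2 g (x 2)) :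
    lap3 (fun z => g (Yf z)) x = (1 - x 2 ^ 2) * deriv (deriv g) (x 2) - 2 * x 2 * deriv g (x 2) := by
  rw [← Yf_one hx] at hg
  rw [lap3_comp (cd1' hg) (cd2 hg) (cd_Y (ne_one hx)), grad_Y_sq (ne_one hx), lap3_Y (ne_one hx),
    Rf_one hx, Yf_one hx]
  ring

lemma cd_gY {g : ℝ → ℝ} {x : V3} (hx : ‖x‖ = 1) (hg : ContDiffAt ℝ 2 g (x 2)) :
    ContDiffAt ℝ 2 (fun z => g (Yf z)) x := by
  rw [← Yf_one hx] at hg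
  exact hg.comp x (cd_Y (ne_one hx))

lemma pd_gYR {g : ℝ → ℝ} {x : V3} (hx : ‖x‖ = 1) (hg : ContDiffAt ℝ 2 g (x 2)) (j : Fin 3) :
    pd j (fun z => g (Yf z) * Rf z) x =
      deriv g (x 2) * ((if (2:Fin 3) = j then 1 else 0) - x 2 * x j) - g (x 2) * x j := by
  rw [pd_mul j (cd_d (cd_gY hx hg)) (cd_d (cd_R (ne_one hx))), pd_gY hx hg, pd_R (ne_one hx),
    Rf_one hx, Yf_one hx]
  ring

lemma lap3_gYR {g : ℝ → ℝ} {x : V3} (hx : ‖x‖ = 1) (hg : ContDiffAt ℝ 2 g (x 2)) :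
    lap3 (fun z => g (Yf z) * Rf z) x =
      (1 - x 2 ^ 2) * deriv (deriv g) (x 2) - 2 * x 2 * deriv g (x 2) := by
  rw [lap3_mul (cd_gY hx hg) (cd_R (ne_one hx)), lap3_gY hx hg, lap3_R (ne_one hx), Rf_one hx]
  have : (∑ j, pd j (fun z => g (Yf z)) x * pd j Rf x) = 0 := by
    have h2 := grad_YR (ne_one hx)
    rw [← Yf_one hx] at hg
    have : ∀ j, pd j (fun z => g (Yf z)) x = deriv g (Yf x) * pd j Yf x := fun j =>
      pd_comp j (cd1 hg) (cd_d (cd_Y (ne_one hx)))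
    simp only [this, mul_assoc]
    rw [← Finset.mul_sum, h2, mul_zero]
  rw [this]; ring

lemma clm_expand (L : V3 →L[ℝ] ℝ) (x : V3) :
    L x = x 0 * L (e3 0) + x 1 * L (e3 1) + x 2 * L (e3 2) := by
  have hx' : x = x 0 • e3 0 + x 1 • e3 1 + x 2 • e3 2 := by
    ext i; fin_cases i <;> simp [e3]
  conv_lhs => rw [hx']
  simp [-PiLp.smul_apply]

/-- Euler identity for the pressure -/
lemma euler_p {u : V3 → V3} {p : V3 → ℝ} (h : Sol u p) {x : V3} (hx : x ∈ Off) :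
    x 0 * pd 0 p x + x 1 * pd 1 p x + x 2 * pd 2 p x = - 2 * p x := by
  have hd := (p_cd h hx).hasFDerivAt
  have hl : HasDerivAt (fun t : ℝ => t • x) x 1 := by
    simpa using (hasDerivAt_id (1:ℝ)).smul_const x
  have hd' : HasFDerivAt p (fderiv ℝ p x) ((1:ℝ) • x) := by simpa using hd
  have h1 := hd'.comp_hasDerivAt (1:ℝ) hl
  have h2 : HasDerivAt (fun t : ℝ => (t ^ 2)⁻¹ * p x) (-2 * p x) 1 := by
    have := ((hasDerivAt_pow 2 (1:ℝ)).fun_inv (by norm_num)).mul_const (p x)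
    exact this.congr_deriv (by norm_num)
  have h3 : (p ∘ fun t : ℝ => t • x) =ᶠ[𝓝 1] (fun t : ℝ => (t ^ 2)⁻¹ * p x) := by
    filter_upwards [lt_mem_nhds (show (0:ℝ) < 1 by norm_num)] with t ht using h.hp x hx t ht
  have h4 := h1.unique (h2.congr_of_eventuallyEq h3)
  rw [← h4]
  unfold pd
  rw [clm_expand (fderiv ℝ p x) x]

lemma pd_cm {f : V3 → ℝ} {x : V3} (i j : Fin 3) (hf : ContDiffAt ℝ 2 f x) :
    pd j (fun z => z i * f z) x = x i * pd j f x + f x * (if i = j then 1 else 0) := by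
  rw [pd_mul j (cd_d (cd_coord i x)) (cd_d hf), pd_coord]

lemma lap3_cm {f : V3 → ℝ} {x : V3} (i : Fin 3) (hf : ContDiffAt ℝ 2 f x) :
    lap3 (fun z => z i * f z) x = x i * lap3 f x + 2 * pd i f x := by
  rw [lap3_mul (cd_coord i x) hf, lap3_coord]
  simp [pd_coord]

section
variable {u : V3 → V3} {p : V3 → ℝ} (h : Sol u p) {x : V3} (hx : x ∈ Off) (hx1 : ‖x‖ = 1)

lemma cm_cd (h : Sol u p) (hx : x ∈ Off) (i k : Fin 3) : ContDiffAt ℝ 2 (fun z : V3 => z i * u z k) x :=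
  (cd_coord i x).mul (u_cd h hx k)

lemma x2_mem (hx : x ∈ Off) (hx1 : ‖x‖ = 1) : x 2 ∈ Set.Ioo (-1:ℝ) 1 := by
  rw [← Yf_one hx1]; exact Y_mem hx

lemma factA (h : Sol u p) (hx : x ∈ Off) (hx1 : ‖x‖ = 1) :
    (∀ j, x 0 * pd j (fun z => u z 0) x + x 1 * pd j (fun z => u z 1) x
      + x 2 * pd j (fun z => u z 2) x + u x j
      = deriv (Fq u) (x 2) * ((if (2:Fin 3) = j then 1 else 0) - x 2 * x j)) ∧
    x 0 * lap3 (fun z => u z 0) x + x 1 * lap3 (fun z => u z 1) x + x 2 * lap3 (fun z => u z 2) x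
      + 2 * (pd 0 (fun z => u z 0) x + pd 1 (fun z => u z 1) x + pd 2 (fun z => u z 2) x)
      = (1 - x 2 ^ 2) * deriv (deriv (Fq u)) (x 2) - 2 * x 2 * deriv (Fq u) (x 2) := by
  have he : (fun z : V3 => z 0 * u z 0 + z 1 * u z 1 + z 2 * u z 2) =ᶠ[𝓝 x] fun z => Fq u (Yf z) := by
    filter_upwards [Off_open.mem_nhds hx] with z hz using (rep h hz).1
  have hF := F_cd h (x2_mem hx hx1)
  have c0 := cm_cd h hx 0 0
  have c1 := cm_cd h hx 1 1
  have c2 := cm_cd h hx 2 2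
  constructor
  · intro j
    have := pd_congr j he
    rw [pd_gY hx1 hF, pd_add j (cd_d (c0.add c1)) (cd_d c2), pd_add j (cd_d c0) (cd_d c1),
      pd_cm _ _ (u_cd h hx 0), pd_cm _ _ (u_cd h hx 1), pd_cm _ _ (u_cd h hx 2)] at this
    rw [← this]
    fin_cases j <;> simp <;> ring
  · have := lap3_congr he
    rw [lap3_gY hx1 hF, lap3_add (c0.add c1) c2, lap3_add c0 c1,
      lap3_cm _ (u_cd h hx 0), lap3_cm _ (u_cd h hx 1), lap3_cm _ (u_cd h hx 2)] at this
    rw [← this]; ring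

lemma factB (h : Sol u p) (hx : x ∈ Off) (hx1 : ‖x‖ = 1) :
    (∀ j, x 0 * pd j (fun z => u z 1) x + u x 1 * (if (0:Fin 3) = j then 1 else 0)
      - (x 1 * pd j (fun z => u z 0) x + u x 0 * (if (1:Fin 3) = j then 1 else 0))
      = deriv (Vq u) (x 2) * ((if (2:Fin 3) = j then 1 else 0) - x 2 * x j)) ∧
    x 0 * lap3 (fun z => u z 1) x - x 1 * lap3 (fun z => u z 0) x
      + 2 * (pd 0 (fun z => u z 1) x - pd 1 (fun z => u z 0) x)
      = (1 - x 2 ^ 2) * deriv (deriv (Vq u)) (x 2) - 2 * x 2 * deriv (Vq u) (x 2) := by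
  have he : (fun z : V3 => z 0 * u z 1 - z 1 * u z 0) =ᶠ[𝓝 x] fun z => Vq u (Yf z) := by
    filter_upwards [Off_open.mem_nhds hx] with z hz using (rep h hz).2.2
  have hF := V_cd h (x2_mem hx hx1)
  have c0 := cm_cd h hx 0 1
  have c1 := cm_cd h hx 1 0
  constructor
  · intro j
    have := pd_congr j he
    rw [pd_gY hx1 hF, pd_sub j (cd_d c0) (cd_d c1),
      pd_cm _ _ (u_cd h hx 0), pd_cm _ _ (u_cd h hx 1)] at this
    exact this
  · have := lap3_congr he
    rw [lap3_gY hx1 hF, lap3_sub c0 c1,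
      lap3_cm _ (u_cd h hx 0), lap3_cm _ (u_cd h hx 1)] at this
    rw [← this]; ring

lemma factD (h : Sol u p) (hx : x ∈ Off) (hx1 : ‖x‖ = 1) :
    (∀ j, pd j (fun z => u z 2) x
      = deriv (Wq u) (x 2) * ((if (2:Fin 3) = j then 1 else 0) - x 2 * x j) - Wq u (x 2) * x j) ∧
    lap3 (fun z => u z 2) x
      = (1 - x 2 ^ 2) * deriv (deriv (Wq u)) (x 2) - 2 * x 2 * deriv (Wq u) (x 2) := by
  have he : (fun z : V3 => u z 2) =ᶠ[𝓝 x] fun z => Wq u (Yf z) * Rf z := by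
    filter_upwards [Off_open.mem_nhds hx] with z hz using (rep h hz).2.1
  have hF := W_cd h (x2_mem hx hx1)
  exact ⟨fun j => by rw [pd_congr j he, pd_gYR hx1 hF], by rw [lap3_congr he, lap3_gYR hx1 hF]⟩

lemma rep1 (h : Sol u p) (hx : x ∈ Off) (hx1 : ‖x‖ = 1) :
    x 0 * u x 0 + x 1 * u x 1 + x 2 * u x 2 = Fq u (x 2) ∧ u x 2 = Wq u (x 2) ∧
    x 0 * u x 1 - x 1 * u x 0 = Vq u (x 2) := by
  simpa [Rf_one hx1, Yf_one hx1] using rep h hx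

/-- squared norm of the field on the sphere -/
def Nq (u : V3 → V3) (y : ℝ) : ℝ :=
  Fq u y ^ 2 + ((y * Fq u y - Wq u y) ^ 2 + Vq u y ^ 2) / (1 - y ^ 2)

lemma normN (h : Sol u p) (hx : x ∈ Off) (hx1 : ‖x‖ = 1) : ‖u x‖ ^ 2 = Nq u (x 2) := by
  obtain ⟨a, b, c⟩ := rep1 h hx hx1
  have hy := s2_pos (x2_mem hx hx1)
  have hn := norm_sq3 x
  rw [hx1] at hn
  unfold Nq
  rw [norm_sq3, ← b, ← c, ← a]
  field_simp
  generalize u x 0 = a0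
  generalize u x 1 = a1
  generalize u x 2 = a2
  have : x 2 ^ 2 = 1 - x 0 ^ 2 - x 1 ^ 2 := by linarith
  have e : ∀ z : ℝ, z ^ 2 = 1 - x 0 ^ 2 - x 1 ^ 2 → (1 - z ^ 2) * (a0 ^ 2 + a1 ^ 2 + a2 ^ 2) =
    (1 - z ^ 2) * (x 0 * a0 + x 1 * a1 + z * a2) ^ 2 +
      (z * (x 0 * a0 + x 1 * a1 + z * a2) - a2) ^ 2 + (x 0 * a1 - x 1 * a0) ^ 2 := by
    intro z hz
    have h1 : (1 - z ^ 2) * (x 0 * a0 + x 1 * a1 + z * a2) ^ 2 +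
      (z * (x 0 * a0 + x 1 * a1 + z * a2) - a2) ^ 2
      = (x 0 * a0 + x 1 * a1) ^ 2 + a2 ^ 2 * (1 - z ^ 2) := by ring
    rw [h1, hz]; ring
  have := e _ this
  linear_combination this

lemma eq_r (h : Sol u p) (hx : x ∈ Off) (hx1 : ‖x‖ = 1) :
    2 * p x = -((1 - x 2 ^ 2) * deriv (deriv (Fq u)) (x 2) - 2 * x 2 * deriv (Fq u) (x 2))
      - (x 2 * Fq u (x 2) - Wq u (x 2)) * deriv (Fq u) (x 2) - Nq u (x 2) := by
  obtain ⟨m, d⟩ := h.ns x hx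
  have m0 := m 0
  have m1 := m 1
  have m2 := m 2
  obtain ⟨a1, a2⟩ := factA h hx hx1
  obtain ⟨a, b, c⟩ := rep1 h hx hx1
  have hE := euler_p h hx
  have b0 := a1 0
  have b1 := a1 1
  have b2 := a1 2
  rw [← normN h hx hx1, norm_sq3]
  simp only [Fin.sum_univ_three] at m0 m1 m2 d
  simp at b0 b1 b2
  linear_combination hE - x 0 * m0 - x 1 * m1 - x 2 * m2 - a2 + 2 * d
    + u x 0 * b0 + u x 1 * b1 + u x 2 * b2 - deriv (Fq u) (x 2) * x 2 * a + deriv (Fq u) (x 2) * b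

end

lemma hasDerivAt_euc {c : ℝ → V3} {c' : V3} {t : ℝ} :
    HasDerivAt c c' t ↔ ∀ i, HasDerivAt (fun s => c s i) (c' i) t := by
  constructor
  · intro h i
    exact ((EuclideanSpace.proj i : V3 →L[ℝ] ℝ).hasFDerivAt.comp_hasDerivAt t h)
  · intro h
    have h1 : HasDerivAt (fun s i => c s i) (fun i => c' i) t := hasDerivAt_pi.2 h
    exact ((EuclideanSpace.equiv (Fin 3) ℝ).symm.toContinuousLinearMap.hasFDerivAt.comp_hasDerivAt t h1)

section
variable {u : V3 → V3} {p : V3 → ℝ} {y : ℝ}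

lemma pd1_p (h : Sol u p) (hy : y ∈ Set.Ioo (-1:ℝ) 1) : pd 1 p (qv y) = 0 := by
  set s := √(1 - y ^ 2) with hs
  have hsp : 0 < s := s_pos hy
  let c : ℝ → V3 := fun t => !₂[s * Real.cos t, s * Real.sin t, y]
  have hc0 : c 0 = qv y := by
    ext i; fin_cases i <;> simp [c, hs]
  have hcd : HasDerivAt c (!₂[0, s, 0] : V3) 0 := by
    rw [hasDerivAt_euc]
    intro i
    fin_cases i
    · exact ((Real.hasDerivAt_cos 0).const_mul s).congr_deriv (by simp)
    · exact ((Real.hasDerivAt_sin 0).const_mul s).congr_deriv (by simp)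
    · exact hasDerivAt_const _ _
  have hcoff : ∀ t, c t ∈ Off := by
    intro t ⟨h0, h1⟩
    have h0' : s * Real.cos t = 0 := h0
    have h1' : s * Real.sin t = 0 := h1
    have := Real.sin_sq_add_cos_sq t
    have a := (mul_eq_zero.1 h0').resolve_left hsp.ne'
    have b := (mul_eq_zero.1 h1').resolve_left hsp.ne'
    rw [a, b] at this; norm_num at this
  have hcn : ∀ t, ‖c t‖ = 1 := by
    intro t
    have : ‖c t‖ ^ 2 = 1 := by
      rw [norm_sq3]
      change (s * Real.cos t) ^ 2 + (s * Real.sin t) ^ 2 + y ^ 2 = 1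
      have e := s_sq hy
      rw [← hs] at e
      linear_combination s ^ 2 * Real.sin_sq_add_cos_sq t + e
    have h := norm_nonneg (c t)
    nlinarith
  have hconst : ∀ t, p (c t) = p (c 0) := by
    intro t
    have e1 := eq_r h (hcoff t) (hcn t)
    have e2 := eq_r h (hcoff 0) (hcn 0)
    have : c t 2 = c 0 2 := rfl
    rw [this] at e1
    linarith
  have hd : HasFDerivAt p (fderiv ℝ p (qv y)) (c 0) := by
    rw [hc0]; exact (p_cd h (qv_off hy)).hasFDerivAt
  have h1 := hd.comp_hasDerivAt (0:ℝ) hcd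
  have h2 : (p ∘ c) = fun _ => p (c 0) := funext hconst
  rw [h2] at h1
  have h3 := h1.unique (hasDerivAt_const _ _)
  rw [clm_expand] at h3
  simp at h3
  exact h3.resolve_left hsp.ne'

lemma eq_div (h : Sol u p) (hy : y ∈ Set.Ioo (-1:ℝ) 1) :
    deriv (Wq u) y = y * deriv (Fq u) y := by
  have hx := qv_off hy
  have hx1 := qv_norm hy
  have hs := s_sq hy
  have hsp := s_pos hy
  have d := (h.ns _ hx).2
  have A := (factA h hx hx1).1
  have B := (factB h hx hx1).1 1
  have D := (factD h hx hx1).1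
  have A0 := A 0
  have D0 := D 0
  have D2 := D 2
  obtain ⟨a, b, c⟩ := rep1 h hx hx1
  simp only [Fin.sum_univ_three] at d
  simp at A0 B D0 D2 d a b c
  set s := √(1 - y ^ 2)
  rw [D0] at A0
  rw [D2] at d
  have key : s ^ 2 * (deriv (Wq u) y - y * deriv (Fq u) y) = 0 := by
    linear_combination s ^ 2 * d - s * A0 - s * B
  have := (mul_eq_zero.1 key).resolve_left (by positivity)
  linarith

lemma eq_phi (h : Sol u p) (hy : y ∈ Set.Ioo (-1:ℝ) 1) :
    (1 - y ^ 2) * deriv (deriv (Vq u)) y + (y * Fq u y - Wq u y) * deriv (Vq u) y = 0 := by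
  have hx := qv_off hy
  have hx1 := qv_norm hy
  have hs := s_sq hy
  have hsp := s_pos hy
  have m := (h.ns _ hx).1 1
  have A := (factA h hx hx1).1 1
  obtain ⟨B, B2⟩ := factB h hx hx1
  have B0 := B 0
  have B1 := B 1
  have Bz := B 2
  have D := (factD h hx hx1).1 1
  obtain ⟨a, b, c⟩ := rep1 h hx hx1
  simp only [Fin.sum_univ_three] at m
  rw [pd1_p h hy] at m
  simp at A B0 B1 Bz D m a b c B2
  set s := √(1 - y ^ 2)
  rw [D] at A
  have key : s * ((1 - y ^ 2) * deriv (deriv (Vq u)) y + (y * Fq u y - Wq u y) * deriv (Vq u) y) = 0 := by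
    linear_combination (-s ^ 2) * m - s * B2 + (2 + s * u (qv y) 0) * B0 - 2 * A
      + s * u (qv y) 1 * B1 + s * u (qv y) 2 * Bz
      - s * y * deriv (Vq u) y * a + s * deriv (Vq u) y * b
  exact (mul_eq_zero.1 key).resolve_left hsp.ne'

lemma P_der (h : Sol u p) (hy : y ∈ Set.Ioo (-1:ℝ) 1) :
    HasDerivAt (Pq p) (deriv (Pq p) y) y ∧
    pd 2 p (qv y) = (1 - y ^ 2) * deriv (Pq p) y - 2 * y * Pq p y := by
  have hx := qv_off hy
  have hs := s_sq hy
  have hsp := s_pos hy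
  have hd := (p_cd h hx).hasFDerivAt
  have hq : HasDerivAt qv (!₂[-y / √(1 - y ^ 2), 0, 1] : V3) y := by
    rw [hasDerivAt_euc]
    intro i
    fin_cases i
    · have h1 : HasDerivAt (fun t : ℝ => 1 - t ^ 2) (-(2 * y)) y := by
        simpa using (hasDerivAt_pow 2 y).const_sub 1
      have := h1.sqrt (s2_pos hy).ne'
      refine this.congr_deriv ?_
      simp; field_simp
    · exact hasDerivAt_const _ _
    · exact hasDerivAt_id _
  have h1 : HasDerivAt (Pq p) _ y := hd.comp_hasDerivAt y hq
  refine ⟨h1.differentiableAt.hasDerivAt, ?_⟩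
  rw [h1.deriv, clm_expand]
  have E := euler_p h hx
  have z := pd1_p h hy
  unfold pd at E z ⊢
  unfold Pq
  simp at E ⊢
  set s := √(1 - y ^ 2)
  have e2 : fderiv ℝ p (qv y) (e3 0) = (-2 * p (qv y) - y * fderiv ℝ p (qv y) (e3 2)) / s := by
    field_simp; linear_combination E
  rw [e2]
  field_simp
  rw [hs]
  have := (s2_pos hy).ne'
  ring

lemma eq_z (h : Sol u p) (hy : y ∈ Set.Ioo (-1:ℝ) 1) :
    - ((1 - y ^ 2) * deriv (deriv (Wq u)) y - 2 * y * deriv (Wq u) y)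
      - (y * Fq u y - Wq u y) * deriv (Wq u) y - Wq u y * Fq u y
      + (1 - y ^ 2) * deriv (Pq p) y - 2 * y * Pq p y = 0 := by
  have hx := qv_off hy
  have hx1 := qv_norm hy
  have hs := s_sq hy
  have hsp := s_pos hy
  have m := (h.ns _ hx).1 2
  obtain ⟨D, DL⟩ := factD h hx hx1
  have D0 := D 0
  have D1 := D 1
  have D2 := D 2
  obtain ⟨a, b, c⟩ := rep1 h hx hx1
  simp only [Fin.sum_univ_three] at m
  rw [(P_der h hy).2, DL] at m
  simp at D0 D1 D2 m a b c
  set s := √(1 - y ^ 2)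
  rw [D0, D1, D2] at m
  linear_combination m + (y * deriv (Wq u) y + Wq u y) * a - deriv (Wq u) y * b

lemma eq_rq (h : Sol u p) (hy : y ∈ Set.Ioo (-1:ℝ) 1) :
    2 * Pq p y = -((1 - y ^ 2) * deriv (deriv (Fq u)) y - 2 * y * deriv (Fq u) y)
      - (y * Fq u y - Wq u y) * deriv (Fq u) y - Nq u y := by
  simpa [Pq] using eq_r h (qv_off hy) (qv_norm hy)

end

abbrev II : Set ℝ := Set.Ioo (-1:ℝ) 1

lemma const_II {g : ℝ → ℝ} (hg : ∀ y ∈ II, HasDerivAt g 0 y) : ∃ k, ∀ y ∈ II, g y = k := by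
  refine ⟨g 0, fun y hy => ?_⟩
  exact isOpen_Ioo.is_const_of_deriv_eq_zero isPreconnected_Ioo
    (fun z hz => (hg z hz).differentiableAt.differentiableWithinAt)
    (fun z hz => (hg z hz).deriv) hy (by norm_num)

lemma V_zero {U V V1 V2 : ℝ → ℝ} (hU : ContinuousOn U II)
    (hV : ∀ y ∈ II, HasDerivAt V (V1 y) y) (hV1 : ∀ y ∈ II, HasDerivAt V1 (V2 y) y)
    (he : ∀ y ∈ II, (1 - y ^ 2) * V2 y + U y * V1 y = 0)
    (hl : Tendsto V (𝓝[>] (-1)) (𝓝 0)) (hr : Tendsto V (𝓝[<] 1) (𝓝 0)) :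
    ∀ y ∈ II, V y = 0 := by
  set f : ℝ → ℝ := fun y => U y / (1 - y ^ 2) with hf
  have hfc : ContinuousOn f II := by
    apply hU.div (by fun_prop)
    intro y hy; exact (s2_pos hy).ne'
  have h0 : (0:ℝ) ∈ II := by norm_num
  have hG : ∀ y ∈ II, HasDerivAt (fun z => ∫ t in (0:ℝ)..z, f t) (f y) y := by
    intro y hy
    have hsub : Set.uIcc 0 y ⊆ II := Set.OrdConnected.uIcc_subset Set.ordConnected_Ioo h0 hy
    apply intervalIntegral.integral_hasDerivAt_right
    · exact (hfc.mono hsub).intervalIntegrable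
    · exact hfc.stronglyMeasurableAtFilter isOpen_Ioo y hy
    · exact hfc.continuousAt (isOpen_Ioo.mem_nhds hy)
  set G : ℝ → ℝ := fun z => ∫ t in (0:ℝ)..z, f t
  obtain ⟨k, hk⟩ : ∃ k, ∀ y ∈ II, V1 y * Real.exp (G y) = k := by
    apply const_II
    intro y hy
    have := (hV1 y hy).mul (hG y hy).exp
    refine this.congr_deriv ?_
    have h2 := he y hy
    have h3 := s2_pos hy
    have : V2 y = - (f y * V1 y) := by
      simp only [hf]; field_simp; linarith
    rw [this]; ring
  obtain ⟨c, hc, hc0⟩ := exists_hasDerivAt_eq_zero' (show (-1:ℝ) < 1 by norm_num) hl hr hV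
  have hk0 : k = 0 := by rw [← hk c hc, hc0]; ring
  have hV10 : ∀ y ∈ II, V1 y = 0 := by
    intro y hy
    have := hk y hy
    rw [hk0] at this
    exact (mul_eq_zero.1 this).resolve_right (Real.exp_ne_zero _)
  obtain ⟨m, hm⟩ := const_II (g := V) (fun y hy => by have := hV y hy; rwa [hV10 y hy] at this)
  have hm0 : m = 0 := by
    have h1 : Tendsto V (𝓝[>] (-1)) (𝓝 m) := by
      apply tendsto_const_nhds.congr'
      filter_upwards [Ioo_mem_nhdsGT (show (-1:ℝ) < 1 by norm_num)] with y hy using (hm y hy).symm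
    exact tendsto_nhds_unique h1 hl
  intro y hy; rw [hm y hy, hm0]

lemma first_int {U F F1 F2 P P1 : ℝ → ℝ}
    (hU : ∀ y ∈ II, HasDerivAt U (F y) y) (hF : ∀ y ∈ II, HasDerivAt F (F1 y) y)
    (hF1 : ∀ y ∈ II, HasDerivAt F1 (F2 y) y) (hP : ∀ y ∈ II, HasDerivAt P (P1 y) y)
    (er : ∀ y ∈ II, 2 * P y = -((1 - y ^ 2) * F2 y - 2 * y * F1 y) - U y * F1 y - F y ^ 2
      - U y ^ 2 / (1 - y ^ 2))
    (ez : ∀ y ∈ II, -((1 - y ^ 2) * (F1 y + y * F2 y) - 2 * y * (y * F1 y)) - U y * (y * F1 y)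
      - (y * F y - U y) * F y + (1 - y ^ 2) * P1 y - 2 * y * P y = 0) :
    ∃ a b c : ℝ, ∀ y ∈ II, (1 - y ^ 2) * F y + 2 * y * U y + U y ^ 2 / 2 = a + b * y + c * y ^ 2 := by
  have hs : ∀ y : ℝ, HasDerivAt (fun t : ℝ => 1 - t ^ 2) (-(2 * y)) y := fun y => by
    simpa using (hasDerivAt_pow 2 y).const_sub 1
  obtain ⟨K, hK⟩ : ∃ K, ∀ y ∈ II, P y - F y + U y ^ 2 / (2 * (1 - y ^ 2)) = K := by
    apply const_II
    intro y hy
    have h3 := s2_pos hy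
    have := ((hP y hy).sub (hF y hy)).add (((hU y hy).pow 2).div ((hs y).const_mul 2) (by positivity))
    refine this.congr_deriv ?_
    have e1 := er y hy
    have e2 := ez y hy
    have e3 : P y = (-((1 - y ^ 2) * F2 y - 2 * y * F1 y) - U y * F1 y - F y ^ 2
      - U y ^ 2 / (1 - y ^ 2)) / 2 := by linarith
    rw [e3] at e2
    have e4 : P1 y = - (-((1 - y ^ 2) * (F1 y + y * F2 y) - 2 * y * (y * F1 y)) - U y * (y * F1 y)
      - (y * F y - U y) * F y - 2 * y * ((-((1 - y ^ 2) * F2 y - 2 * y * F1 y) - U y * F1 y - F y ^ 2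
      - U y ^ 2 / (1 - y ^ 2)) / 2)) / (1 - y ^ 2) := by
      rw [_root_.eq_div_iff h3.ne']; linarith
    rw [e4]
    field_simp
    simp
    ring
  obtain ⟨k2, hk2⟩ : ∃ K', ∀ y ∈ II, (1 - y ^ 2) * F1 y + U y * F y + 2 * U y + 2 * K * y = K' := by
    apply const_II
    intro y hy
    have h3 := s2_pos hy
    have := ((((hs y).mul (hF1 y hy)).add ((hU y hy).mul (hF y hy))).add ((hU y hy).const_mul 2)).add
      ((hasDerivAt_id y).const_mul (2 * K))
    refine this.congr_deriv ?_
    have e1 := er y hy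
    have e2 := hK y hy
    have : U y ^ 2 / (1 - y ^ 2) = 2 * (U y ^ 2 / (2 * (1 - y ^ 2))) := by field_simp
    rw [this] at e1
    linear_combination e1 - 2 * e2
  obtain ⟨k3, hk3⟩ : ∃ K', ∀ y ∈ II, (1 - y ^ 2) * F y + 2 * y * U y + U y ^ 2 / 2 - k2 * y + K * y ^ 2
      = K' := by
    apply const_II
    intro y hy
    have := (((((hs y).mul (hF y hy)).add (((hasDerivAt_id y).const_mul 2).mul (hU y hy))).add
      (((hU y hy).pow 2).div_const 2)).sub ((hasDerivAt_id y).const_mul k2)).add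
      ((hasDerivAt_pow 2 y).const_mul K)
    refine this.congr_deriv ?_
    have e2 := hk2 y hy
    simp
    linear_combination e2
  exact ⟨k3, k2, -K, fun y hy => by linear_combination hk3 y hy⟩

lemma end_analysis {U F : ℝ → ℝ} (hU : ∀ y ∈ II, HasDerivAt U (F y) y) {a b c : ℝ}
    (hq : ∀ y ∈ II, (1 - y ^ 2) * F y + 2 * y * U y + U y ^ 2 / 2 = a + b * y + c * y ^ 2)
    (hUl : Tendsto U (𝓝[>] (-1)) (𝓝 0)) (hUr : Tendsto U (𝓝[<] 1) (𝓝 0))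
    (hFl : Tendsto (fun y => (1 - y ^ 2) * F y) (𝓝[>] (-1)) (𝓝 0))
    {M : ℝ} (hM : ∀ᶠ y in 𝓝[<] 1, |F y| ≤ M)
    {K : ℝ} (hK : ∀ᶠ y in 𝓝[>] (-1), |F y| ≤ K * (1 - y ^ 2) ^ (-(1/4) : ℝ)) :
    ∃ B, ∀ᶠ y in 𝓝[>] (-1), |F y| ≤ B ∧ |U y| ≤ B * (1 - y ^ 2) := by
  have hIl : ∀ᶠ y in 𝓝[>] (-1:ℝ), y ∈ II := Ioo_mem_nhdsGT (by norm_num)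
  have hIr : ∀ᶠ y in 𝓝[<] (1:ℝ), y ∈ II := Ioo_mem_nhdsLT (by norm_num)
  have hid : ∀ {e : ℝ} {s : Set ℝ}, Tendsto (fun y : ℝ => y) (𝓝[s] e) (𝓝 e) :=
    fun {e s} => tendsto_nhdsWithin_of_tendsto_nhds tendsto_id
  have hpoly : ∀ {e : ℝ} {s : Set ℝ}, Tendsto (fun y : ℝ => a + b * y + c * y ^ 2) (𝓝[s] e)
      (𝓝 (a + b * e + c * e ^ 2)) := fun {e s} =>
    tendsto_nhdsWithin_of_tendsto_nhds (Continuous.tendsto (by fun_prop) e)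
  -- step a
  have hFr : Tendsto (fun y => (1 - y ^ 2) * F y) (𝓝[<] 1) (𝓝 0) := by
    have h0 : Tendsto (fun y : ℝ => (1 - y ^ 2)) (𝓝[<] 1) (𝓝 0) := by
      apply tendsto_nhdsWithin_of_tendsto_nhds
      have : Continuous (fun y : ℝ => (1 - y ^ 2)) := by fun_prop
      simpa using this.tendsto 1
    apply h0.zero_mul_isBoundedUnder_le
    exact ⟨M, by simpa using hM⟩
  have e1 : a + b * (-1) + c * (-1) ^ 2 = 0 := by
    have h1 : Tendsto (fun y => (1 - y ^ 2) * F y + 2 * y * U y + U y ^ 2 / 2) (𝓝[>] (-1)) (𝓝 0) := by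
      have := (hFl.add ((hid.const_mul 2).mul hUl)).add ((hUl.pow 2).div_const 2)
      simpa using this
    refine tendsto_nhds_unique hpoly (h1.congr' ?_)
    filter_upwards [hIl] with y hy using hq y hy
  have e2 : a + b * 1 + c * 1 ^ 2 = 0 := by
    have h1 : Tendsto (fun y => (1 - y ^ 2) * F y + 2 * y * U y + U y ^ 2 / 2) (𝓝[<] 1) (𝓝 0) := by
      have := (hFr.add ((hid.const_mul 2).mul hUr)).add ((hUr.pow 2).div_const 2)
      simpa using this
    refine tendsto_nhds_unique hpoly (h1.congr' ?_)
    filter_upwards [hIr] with y hy using hq y hy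
  have eb : b = 0 := by linarith
  have ec : c = -a := by linarith
  subst eb ec
  set f : ℝ → ℝ := fun y => U y / (1 - y ^ 2) with hf
  have hs : ∀ y : ℝ, HasDerivAt (fun t : ℝ => 1 - t ^ 2) (-(2 * y)) y := fun y => by
    simpa using (hasDerivAt_pow 2 y).const_sub 1
  have hUf : ∀ y ∈ II, U y = (1 - y ^ 2) * f y := by
    intro y hy
    have := s2_pos hy
    simp only [hf]; field_simp
  have hfd : ∀ y ∈ II, HasDerivAt f (a / (1 - y ^ 2) - f y ^ 2 / 2) y := by
    intro y hy
    have h3 := s2_pos hy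
    refine ((hU y hy).div (hs y) h3.ne').congr_deriv ?_
    have e := hq y hy
    have : F y = (a + 0 * y + -a * y ^ 2 - 2 * y * U y - U y ^ 2 / 2) / (1 - y ^ 2) := by
      rw [_root_.eq_div_iff h3.ne']; linarith
    rw [this]
    simp only [hf]
    field_simp
    ring
  -- step b
  obtain ⟨y0, hy0, hy0M⟩ : ∃ y0 ∈ Set.Ioo (0:ℝ) 1, ∀ y ∈ Set.Ioo y0 1, |F y| ≤ M := by
    obtain ⟨l, hl, h⟩ := (mem_nhdsLT_iff_exists_Ioo_subset' (show (0:ℝ) < 1 by norm_num)).1 hM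
    refine ⟨max l (1/2), ⟨by positivity, by simpa using ⟨hl, by norm_num⟩⟩, fun y hy => ?_⟩
    exact h ⟨lt_of_le_of_lt (le_max_left _ _) hy.1, hy.2⟩
  have hM0 : 0 ≤ M := (abs_nonneg _).trans (hy0M ((y0 + 1) / 2) ⟨by linarith [hy0.2], by linarith [hy0.2]⟩)
  have hsubI : ∀ y ∈ Set.Ioo y0 1, y ∈ II := fun y hy => ⟨by linarith [hy0.1, hy.1], hy.2⟩
  have hUM : ∀ y ∈ Set.Ioo y0 1, |U y| ≤ M * (1 - y) := by
    intro y hy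
    have h1 : ∀ z ∈ Set.Ioo y0 1, |U z - U y| ≤ M * |z - y| := by
      intro z hz
      exact (convex_Ioo y0 1).norm_image_sub_le_of_norm_hasDerivWithin_le
        (fun t ht => (hU t (hsubI t ht)).hasDerivWithinAt) (fun t ht => hy0M t ht) hy hz
    have h2 : Tendsto (fun z => |U z - U y|) (𝓝[<] 1) (𝓝 |0 - U y|) := (hUr.sub_const _).abs
    have h3 : Tendsto (fun z : ℝ => M * |z - y|) (𝓝[<] 1) (𝓝 (M * |1 - y|)) :=
      ((hid.sub_const y).abs).const_mul M
    have h4 := le_of_tendsto_of_tendsto h2 h3 (by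
      filter_upwards [Ioo_mem_nhdsLT hy0.2] with z hz using h1 z hz)
    rw [abs_of_pos (show 0 < 1 - y by linarith [hy.2])] at h4
    simpa using h4
  have hfM : ∀ y ∈ Set.Ioo y0 1, |f y| ≤ M := by
    intro y hy
    have h3 := s2_pos (hsubI y hy)
    simp only [hf]
    rw [abs_div, abs_of_pos h3, div_le_iff₀ h3]
    have := hUM y hy
    have h4 : 1 - y ≤ 1 - y ^ 2 := by nlinarith [hy.1, hy.2, hy0.1]
    nlinarith
  -- step c
  have ha : a = 0 := by
    by_contra hane
    set g : ℝ → ℝ := fun y => f y - a / 2 * (Real.log (1 + y) - Real.log (1 - y)) with hg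
    have hgd : ∀ y ∈ II, HasDerivAt g (- f y ^ 2 / 2) y := by
      intro y hy
      have p1 : 0 < 1 + y := by linarith [hy.1]
      have p2 : 0 < 1 - y := by linarith [hy.2]
      have h1 : HasDerivAt (fun t => Real.log (1 + t)) (1 / (1 + y)) y :=
        ((hasDerivAt_id y).const_add 1).log p1.ne'
      have h2 : HasDerivAt (fun t => Real.log (1 - t)) (-1 / (1 - y)) y :=
        ((hasDerivAt_id y).const_sub 1).log p2.ne'
      refine ((hfd y hy).sub ((h1.sub h2).const_mul (a / 2))).congr_deriv ?_
      have : 1 - y ^ 2 = (1 + y) * (1 - y) := by ring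
      rw [this]
      field_simp
      ring
    set y1 := (y0 + 1) / 2 with hy1
    have hy1m : y1 ∈ Set.Ioo y0 1 := ⟨by rw [hy1]; linarith [hy0.2], by rw [hy1]; linarith [hy0.2]⟩
    have hgb : ∀ z ∈ Set.Ioo y0 1, |g z - g y1| ≤ M ^ 2 / 2 * |z - y1| := by
      intro z hz
      refine (convex_Ioo y0 1).norm_image_sub_le_of_norm_hasDerivWithin_le
        (fun t ht => (hgd t (hsubI t ht)).hasDerivWithinAt) (fun t ht => ?_) hy1m hz
      have := hfM t ht
      have h5 := sq_abs (f t)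
      rw [Real.norm_eq_abs, neg_div, abs_neg, abs_of_nonneg (by positivity)]
      have := abs_nonneg (f t)
      nlinarith
    have hlim : Tendsto (fun z : ℝ => Real.log (1 - z)) (𝓝[<] 1) atBot := by
      apply Real.tendsto_log_nhdsGT_zero.comp
      apply tendsto_nhdsWithin_iff.2 ⟨?_, ?_⟩
      · simpa using (hid (e := 1) (s := Set.Iio 1)).const_sub 1
      · filter_upwards [self_mem_nhdsWithin] with z hz
        simpa using hz
    have hlim2 := tendsto_abs_atBot_atTop.comp hlim
    have hlim3 := hlim2.const_mul_atTop (show 0 < |a / 2| by positivity)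
    obtain ⟨z, hz1, hz2⟩ := ((hlim3.eventually_gt_atTop (|g y1| + M ^ 2 / 2 + M + |a / 2|)).and
      (Ioo_mem_nhdsLT hy0.2)).exists
    have b1 := hgb z hz2
    have b2 := hfM z hz2
    have b3 : |z - y1| ≤ 1 := by
      rw [abs_le]; constructor <;> linarith [hz2.1, hz2.2, hy1m.1, hy1m.2, hy0.1]
    have b4 : |Real.log (1 + z)| ≤ 1 := by
      have p : 0 < z := by linarith [hz2.1, hy0.1]
      rw [abs_of_nonneg (Real.log_nonneg (by linarith))]
      have := Real.log_le_sub_one_of_pos (show 0 < 1 + z by linarith)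
      linarith [hz2.2]
    have b5 : a / 2 * Real.log (1 - z) = (g z - g y1) + g y1 - f z + a / 2 * Real.log (1 + z) := by
      simp only [hg]; ring
    have b6 : |a / 2| * |Real.log (1 - z)| ≤ |g z - g y1| + |g y1| + |f z| + |a / 2| * |Real.log (1 + z)| := by
      rw [← abs_mul, ← abs_mul, b5]
      exact (abs_add_le _ _).trans (by gcongr; exact (abs_sub _ _).trans (by gcongr; exact abs_add_le _ _))
    have b7 : |a / 2| * |Real.log (1 + z)| ≤ |a / 2| := by
      have := abs_nonneg (a / 2); nlinarith
    have b8 : M ^ 2 / 2 * |z - y1| ≤ M ^ 2 / 2 := by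
      have : 0 ≤ M ^ 2 / 2 := by positivity
      nlinarith
    simp only [Function.comp] at hz1
    linarith
  subst ha
  -- step d
  obtain ⟨x0, hx0, hx0K⟩ : ∃ x0 ∈ Set.Ioo (-1:ℝ) 0, ∀ y ∈ Set.Ioo (-1) x0,
      |F y| ≤ K * (1 - y ^ 2) ^ (-(1/4) : ℝ) := by
    obtain ⟨l, hl, h⟩ := (mem_nhdsGT_iff_exists_Ioo_subset' (show (-1:ℝ) < 0 by norm_num)).1 hK
    have hl' : -1 < l := hl
    refine ⟨min l (-1/2), ⟨by simpa using ⟨hl', by norm_num⟩, ?_⟩, fun y hy => ?_⟩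
    · exact lt_of_le_of_lt (min_le_right _ _) (by norm_num)
    · exact h ⟨hy.1, lt_of_lt_of_le hy.2 (min_le_left _ _)⟩
  have hsubL : ∀ y ∈ Set.Ioo (-1) x0, y ∈ II := fun y hy => ⟨hy.1, by linarith [hx0.2, hy.2]⟩
  have hK0 : 0 ≤ K := by
    have hm : (x0 - 1) / 2 ∈ Set.Ioo (-1) x0 := ⟨by linarith [hx0.1], by linarith [hx0.1]⟩
    have h1 := (abs_nonneg _).trans (hx0K _ hm)
    exact nonneg_of_mul_nonneg_left h1 (Real.rpow_pos_of_pos (s2_pos (hsubL _ hm)) _)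
  have hFK : ∀ y ∈ Set.Ioo (-1) x0, |F y| ≤ K * (1 + y) ^ (-(1/4) : ℝ) := by
    intro y hy
    refine (hx0K y hy).trans ?_
    gcongr ?_ * ?_
    apply Real.rpow_le_rpow_of_nonpos (by linarith [hy.1]) _ (by norm_num)
    nlinarith [hy.1, hy.2, hx0.2]
  set A : ℝ → ℝ := fun y => K * (4/3) * (1 + y) ^ (3/4 : ℝ) with hA
  have hAd : ∀ y ∈ Set.Ioo (-1) x0, HasDerivAt A (K * (1 + y) ^ (-(1/4) : ℝ)) y := by
    intro y hy
    have p1 : 0 < 1 + y := by linarith [hy.1]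
    have := (((hasDerivAt_id y).const_add 1).rpow_const (p := (3/4:ℝ)) (Or.inl p1.ne')).const_mul (K * (4/3))
    refine this.congr_deriv ?_
    simp only [id]
    rw [show (3/4 - 1 : ℝ) = -(1/4) by norm_num]; ring
  have hA0 : Tendsto A (𝓝[>] (-1)) (𝓝 0) := by
    have : Continuous A := by
      have : Continuous (fun y : ℝ => (1 + y) ^ (3/4 : ℝ)) :=
        (by fun_prop : Continuous fun y : ℝ => 1 + y).rpow_const (fun _ => Or.inr (by norm_num))
      exact continuous_const.mul this
    have h2 := this.tendsto (-1)
    have h3 : A (-1) = 0 := by simp [hA]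
    rw [h3] at h2
    exact tendsto_nhdsWithin_of_tendsto_nhds h2
  have hmono : ∀ (g g' : ℝ → ℝ), (∀ y ∈ Set.Ioo (-1) x0, HasDerivAt g (g' y) y) →
      (∀ y ∈ Set.Ioo (-1) x0, 0 ≤ g' y) → MonotoneOn g (Set.Ioo (-1) x0) := by
    intro g g' h1 h2
    apply monotoneOn_of_deriv_nonneg (convex_Ioo _ _)
      (fun y hy => (h1 y hy).continuousAt.continuousWithinAt)
    · intro y hy; rw [interior_Ioo] at hy
      exact (h1 y hy).differentiableAt.differentiableWithinAt
    · intro y hy; rw [interior_Ioo] at hy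
      rw [(h1 y hy).deriv]; exact h2 y hy
  have hmono0 : ∀ (g g' : ℝ → ℝ), (∀ y ∈ Set.Ioo (-1) x0, HasDerivAt g (g' y) y) →
      (∀ y ∈ Set.Ioo (-1) x0, 0 ≤ g' y) → Tendsto g (𝓝[>] (-1)) (𝓝 0) →
      ∀ y ∈ Set.Ioo (-1) x0, 0 ≤ g y := by
    intro g g' h1 h2 h3 y hy
    apply le_of_tendsto h3
    filter_upwards [Ioo_mem_nhdsGT hy.1] with z hz
    exact hmono g g' h1 h2 ⟨hz.1, hz.2.trans hy.2⟩ hy hz.2.le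
  have hUA : ∀ y ∈ Set.Ioo (-1) x0, |U y| ≤ A y := by
    intro y hy
    have h1 := hmono0 (fun y => A y - U y) _ (fun y hy => (hAd y hy).sub (hU y (hsubL y hy)))
      (fun y hy => by linarith [(abs_le.1 (hFK y hy)).2]) (by simpa using hA0.sub hUl) y hy
    have h2 := hmono0 (fun y => A y + U y) _ (fun y hy => (hAd y hy).add (hU y (hsubL y hy)))
      (fun y hy => by linarith [(abs_le.1 (hFK y hy)).1]) (by simpa using hA0.add hUl) y hy
    rw [abs_le]; constructor <;> linarith
  set L : ℝ := (K * (4/3)) ^ 2 with hL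
  have hfL : ∀ y ∈ Set.Ioo (-1) x0, f y ^ 2 ≤ L / √(1 + y) := by
    intro y hy
    have p1 : 0 < 1 + y := by linarith [hy.1]
    have h3 := s2_pos (hsubL y hy)
    have h4 : 1 + y ≤ 1 - y ^ 2 := by nlinarith [hy.1, hy.2, hx0.2]
    have h5 : U y ^ 2 ≤ L * ((1 + y) * √(1 + y)) := by
      have := hUA y hy
      have h6 : U y ^ 2 ≤ A y ^ 2 := sq_le_sq' (by linarith [(abs_le.1 this).1]) (abs_le.1 this).2
      refine h6.trans (le_of_eq ?_)
      simp only [hA, hL]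
      rw [mul_pow, ← Real.rpow_natCast ((1 + y) ^ (3/4:ℝ)), ← Real.rpow_mul p1.le, Real.sqrt_eq_rpow]
      congr 1
      nth_rewrite 2 [← Real.rpow_one (1 + y)]
      rw [← Real.rpow_add p1]; norm_num
    have h7 : 0 < √(1 + y) := Real.sqrt_pos.2 p1
    have h8 : √(1 + y) ^ 2 = 1 + y := Real.sq_sqrt p1.le
    simp only [hf]
    rw [div_pow, div_le_div_iff₀ (by positivity) h7]
    calc U y ^ 2 * √(1 + y) ≤ L * ((1 + y) * √(1 + y)) * √(1 + y) := by gcongr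
      _ = L * (1 + y) ^ 2 := by linear_combination L * (1 + y) * h8
      _ ≤ L * (1 - y ^ 2) ^ 2 := by gcongr
  have hfd0 : ∀ y ∈ Set.Ioo (-1) x0, HasDerivAt f (- f y ^ 2 / 2) y := by
    intro y hy
    refine (hfd y (hsubL y hy)).congr_deriv (by ring)
  have hm1 : MonotoneOn (fun y => - f y) (Set.Ioo (-1) x0) :=
    hmono _ _ (fun y hy => (hfd0 y hy).neg) (fun y hy => by nlinarith [sq_nonneg (f y)])
  have hm2 : MonotoneOn (fun y => f y + L * √(1 + y)) (Set.Ioo (-1) x0) := by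
    refine hmono _ (fun y => - f y ^ 2 / 2 + L * (1 / (2 * √(1 + y)))) (fun y hy => ?_) (fun y hy => ?_)
    · have p1 : 0 < 1 + y := by linarith [hy.1]
      exact (hfd0 y hy).add ((((hasDerivAt_id y).const_add 1).sqrt p1.ne').const_mul L)
    · have := hfL y hy
      have e : L * (1 / (2 * √(1 + y))) = (L / √(1 + y)) / 2 := by ring
      rw [e]; linarith
  set x1 := (x0 - 1) / 2 with hx1
  have hx1m : x1 ∈ Set.Ioo (-1) x0 := ⟨by rw [hx1]; linarith [hx0.1], by rw [hx1]; linarith [hx0.1]⟩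
  set B := |f x1| + L * √(1 + x1) with hB
  have hL0 : 0 ≤ L := sq_nonneg _
  have hB0 : 0 ≤ B := by positivity
  have hfB : ∀ y ∈ Set.Ioo (-1) x1, |f y| ≤ B := by
    intro y hy
    have hy' : y ∈ Set.Ioo (-1) x0 := ⟨hy.1, hy.2.trans hx1m.2⟩
    have a1 := hm1 hy' hx1m hy.2.le
    have a2 := hm2 hy' hx1m hy.2.le
    simp only at a1 a2
    have a3 : 0 ≤ L * √(1 + y) := by positivity
    have a4 : 0 ≤ L * √(1 + x1) := by positivity
    rw [abs_le]
    constructor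
    · linarith [neg_abs_le (f x1)]
    · linarith [le_abs_self (f x1)]
  refine ⟨2 * B + B ^ 2, ?_⟩
  filter_upwards [Ioo_mem_nhdsGT hx1m.1] with y hy
  have hyI : y ∈ II := hsubL y ⟨hy.1, hy.2.trans hx1m.2⟩
  have h3 := s2_pos hyI
  have hfy := hfB y hy
  have hUy := hUf y hyI
  have hFe : F y = - 2 * y * f y - (1 - y ^ 2) * f y ^ 2 / 2 := by
    have e := hq y hyI
    rw [hUy] at e
    have : (1 - y ^ 2) * (F y - (- 2 * y * f y - (1 - y ^ 2) * f y ^ 2 / 2)) = 0 := by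
      linear_combination e
    linarith [(mul_eq_zero.1 this).resolve_left h3.ne']
  have hy1 : |y| ≤ 1 := abs_le.2 ⟨hyI.1.le, hyI.2.le⟩
  have hf2 : f y ^ 2 ≤ B ^ 2 := by rw [← sq_abs]; gcongr
  constructor
  · rw [hFe]
    have q1 : |-2 * y * f y| ≤ 2 * B := by
      rw [abs_mul, abs_mul]; norm_num
      have := mul_le_mul hy1 hfy (abs_nonneg _) (by norm_num)
      linarith
    have q2 : |(1 - y ^ 2) * f y ^ 2 / 2| ≤ B ^ 2 := by
      rw [abs_of_nonneg (by positivity)]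
      nlinarith [sq_nonneg y, sq_nonneg (f y)]
    exact (abs_sub _ _).trans (by linarith)
  · rw [hUy, abs_mul, abs_of_pos h3]
    nlinarith [sq_nonneg B]

lemma nII1 : 𝓝[II] (1:ℝ) = 𝓝[<] 1 := nhdsWithin_Ioo_eq_nhdsLT (by norm_num)
lemma nIIm1 : 𝓝[II] (-1:ℝ) = 𝓝[>] (-1) := nhdsWithin_Ioo_eq_nhdsGT (by norm_num)

section
variable {u : V3 → V3} {p : V3 → ℝ}

def Uq (u : V3 → V3) (y : ℝ) : ℝ := y * Fq u y - Wq u y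

lemma rpow_aux {w : ℝ} (h3 : 0 < w) : w * (w ^ (-(1/4) : ℝ)) ^ 2 = (w ^ (1/4 : ℝ)) ^ 2 := by
  rw [← Real.rpow_natCast, ← Real.rpow_natCast, ← Real.rpow_mul h3.le, ← Real.rpow_mul h3.le]
  nth_rewrite 1 [← Real.rpow_one w]
  rw [← Real.rpow_add h3]; norm_num

lemma N_bound {y K : ℝ} (hy : y ∈ II) (hK : 0 ≤ K)
    (hN : Nq u y ≤ (K * (1 - y ^ 2) ^ (-(1/4) : ℝ)) ^ 2) :
    |Fq u y| ≤ K * (1 - y ^ 2) ^ (-(1/4) : ℝ) ∧ |Uq u y| ≤ K * (1 - y ^ 2) ^ (1/4 : ℝ) ∧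
    |Vq u y| ≤ K * (1 - y ^ 2) ^ (1/4 : ℝ) := by
  have h3 := s2_pos hy
  have e := rpow_aux h3
  unfold Nq at hN
  change Fq u y ^ 2 + (Uq u y ^ 2 + Vq u y ^ 2) / (1 - y ^ 2) ≤ _ at hN
  have n1 : 0 ≤ (1 - y ^ 2) ^ (-(1/4) : ℝ) := Real.rpow_nonneg h3.le _
  have n2 : 0 ≤ (1 - y ^ 2) ^ (1/4 : ℝ) := Real.rpow_nonneg h3.le _
  have hd : 0 ≤ (Uq u y ^ 2 + Vq u y ^ 2) / (1 - y ^ 2) := by positivity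
  have h2 : (Uq u y ^ 2 + Vq u y ^ 2) / (1 - y ^ 2) ≤ (K * (1 - y ^ 2) ^ (-(1/4) : ℝ)) ^ 2 := by
    nlinarith [sq_nonneg (Fq u y)]
  rw [div_le_iff₀ h3] at h2
  have h4 : Uq u y ^ 2 + Vq u y ^ 2 ≤ (K * (1 - y ^ 2) ^ (1/4 : ℝ)) ^ 2 := by
    rw [mul_pow, ← e]; linarith
  refine ⟨abs_le_of_sq_le_sq (by linarith) (by positivity),
    abs_le_of_sq_le_sq (by nlinarith [sq_nonneg (Vq u y)]) (by positivity),
    abs_le_of_sq_le_sq (by nlinarith [sq_nonneg (Uq u y)]) (by positivity)⟩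

lemma s2_tendsto {e : ℝ} (he : e = 1 ∨ e = -1) {α : ℝ} (hα : 0 < α) :
    Tendsto (fun y : ℝ => (1 - y ^ 2) ^ α) (𝓝[II] e) (𝓝 0) := by
  have hc : Continuous (fun y : ℝ => (1 - y ^ 2) ^ α) :=
    (by fun_prop : Continuous fun y : ℝ => 1 - y ^ 2).rpow_const (fun _ => Or.inr hα.le)
  have := hc.tendsto e
  have h0 : (1 - e ^ 2) ^ α = 0 := by
    rcases he with rfl | rfl <;> simp [hα.ne']
  rw [h0] at this
  exact tendsto_nhdsWithin_of_tendsto_nhds this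

lemma N_lim {e K : ℝ} (he : e = 1 ∨ e = -1) (hK : 0 ≤ K)
    (hN : ∀ᶠ y in 𝓝[II] e, Nq u y ≤ (K * (1 - y ^ 2) ^ (-(1/4) : ℝ)) ^ 2) :
    Tendsto (Uq u) (𝓝[II] e) (𝓝 0) ∧ Tendsto (Vq u) (𝓝[II] e) (𝓝 0) ∧
    Tendsto (fun y => (1 - y ^ 2) * Fq u y) (𝓝[II] e) (𝓝 0) ∧
    ∀ᶠ y in 𝓝[II] e, |Fq u y| ≤ K * (1 - y ^ 2) ^ (-(1/4) : ℝ) := by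
  have hI : ∀ᶠ y in 𝓝[II] e, y ∈ II := self_mem_nhdsWithin
  have t1 : Tendsto (fun y : ℝ => K * (1 - y ^ 2) ^ (1/4 : ℝ)) (𝓝[II] e) (𝓝 0) := by
    simpa using (s2_tendsto he (show (0:ℝ) < 1/4 by norm_num)).const_mul K
  have t2 : Tendsto (fun y : ℝ => K * (1 - y ^ 2) ^ (3/4 : ℝ)) (𝓝[II] e) (𝓝 0) := by
    simpa using (s2_tendsto he (show (0:ℝ) < 3/4 by norm_num)).const_mul K
  refine ⟨squeeze_zero_norm' ?_ t1, squeeze_zero_norm' ?_ t1, squeeze_zero_norm' ?_ t2, ?_⟩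
  · filter_upwards [hN, hI] with y h1 h2 using (N_bound h2 hK h1).2.1
  · filter_upwards [hN, hI] with y h1 h2 using (N_bound h2 hK h1).2.2
  · filter_upwards [hN, hI] with y h1 h2
    have h3 := s2_pos h2
    rw [Real.norm_eq_abs, abs_mul, abs_of_pos h3]
    have := (N_bound h2 hK h1).1
    calc (1 - y ^ 2) * |Fq u y| ≤ (1 - y ^ 2) * (K * (1 - y ^ 2) ^ (-(1/4) : ℝ)) := by gcongr
      _ = K * ((1 - y ^ 2) ^ (1 : ℝ) * (1 - y ^ 2) ^ (-(1/4) : ℝ)) := by rw [Real.rpow_one]; ring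
      _ = _ := by rw [← Real.rpow_add h3]; norm_num
  · filter_upwards [hN, hI] with y h1 h2 using (N_bound h2 hK h1).1

lemma U_der (h : Sol u p) {y : ℝ} (hy : y ∈ II) : HasDerivAt (Uq u) (Fq u y) y := by
  have := ((hasDerivAt_id y).mul (cd1 (F_cd h hy))).sub (cd1 (W_cd h hy))
  refine this.congr_deriv ?_
  rw [eq_div h hy]; simp

lemma core (h : Sol u p) {e K M : ℝ} (he : e = 1 ∨ e = -1) (hK : 0 ≤ K) (hM : 0 ≤ M)
    (hN : ∀ᶠ y in 𝓝[II] e, Nq u y ≤ (K * (1 - y ^ 2) ^ (-(1/4) : ℝ)) ^ 2)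
    (hN' : ∀ᶠ y in 𝓝[II] (-e), Nq u y ≤ M ^ 2) :
    ∃ B, ∀ᶠ y in 𝓝[II] e, Nq u y ≤ B := by
  have he' : -e = 1 ∨ -e = -1 := by rcases he with rfl | rfl <;> simp
  have hI : ∀ᶠ y in 𝓝[II] e, y ∈ II := self_mem_nhdsWithin
  have hI' : ∀ᶠ y in 𝓝[II] (-e), y ∈ II := self_mem_nhdsWithin
  have hN2 : ∀ᶠ y in 𝓝[II] (-e), Nq u y ≤ (M * (1 - y ^ 2) ^ (-(1/4) : ℝ)) ^ 2 := by
    filter_upwards [hN', hI'] with y h1 h2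
    refine h1.trans ?_
    have h3 := s2_pos h2
    have : 1 ≤ (1 - y ^ 2) ^ (-(1/4) : ℝ) :=
      Real.one_le_rpow_of_pos_of_le_one_of_nonpos h3 (by nlinarith [sq_nonneg y]) (by norm_num)
    gcongr
    exact le_mul_of_one_le_right hM this
  have hF' : ∀ᶠ y in 𝓝[II] (-e), |Fq u y| ≤ M := by
    filter_upwards [hN', hI'] with y h1 h2
    have h3 := s2_pos h2
    refine abs_le_of_sq_le_sq (le_trans ?_ h1) hM
    unfold Nq
    have : 0 ≤ ((y * Fq u y - Wq u y) ^ 2 + Vq u y ^ 2) / (1 - y ^ 2) := by positivity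
    linarith
  obtain ⟨a1, a2, a3, a4⟩ := N_lim he hK hN
  obtain ⟨b1, b2, b3, b4⟩ := N_lim he' hM hN2
  have hV : ∀ y ∈ II, Vq u y = 0 := by
    have hl : Tendsto (Vq u) (𝓝[>] (-1)) (𝓝 0) := by
      rw [← nIIm1]; rcases he with rfl | rfl
      · exact b2
      · exact a2
    have hr : Tendsto (Vq u) (𝓝[<] 1) (𝓝 0) := by
      rw [← nII1]; rcases he with rfl | rfl
      · exact a2
      · simpa using b2
    exact V_zero (U := Uq u) (fun y hy => (U_der h hy).continuousAt.continuousWithinAt)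
      (fun y hy => cd1 (V_cd h hy)) (fun y hy => cd2 (V_cd h hy)) (fun y hy => eq_phi h hy) hl hr
  have hNe : ∀ y ∈ II, Nq u y = Fq u y ^ 2 + Uq u y ^ 2 / (1 - y ^ 2) := by
    intro y hy
    unfold Nq; rw [hV y hy]; unfold Uq; simp
  obtain ⟨a, b, c, hq⟩ := first_int (U := Uq u) (F := Fq u) (F1 := deriv (Fq u))
    (F2 := deriv (deriv (Fq u))) (P := Pq p) (P1 := deriv (Pq p))
    (fun y hy => U_der h hy) (fun y hy => cd1 (F_cd h hy)) (fun y hy => cd2 (F_cd h hy))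
    (fun y hy => (P_der h hy).1)
    (fun y hy => by
      rw [eq_rq h hy, hNe y hy]; unfold Uq; ring)
    (fun y hy => by
      have h1 := eq_z h hy
      have h2 : deriv (deriv (Wq u)) y = deriv (Fq u) y + y * deriv (deriv (Fq u)) y := by
        have : deriv (Wq u) =ᶠ[𝓝 y] fun t => t * deriv (Fq u) t := by
          filter_upwards [isOpen_Ioo.mem_nhds hy] with t ht using eq_div h ht
        rw [this.deriv_eq]
        have h3 := (hasDerivAt_id y).mul (cd2 (F_cd h hy))
        have h4 : HasDerivAt (fun t => t * deriv (Fq u) t) _ y := h3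
        rw [h4.deriv]; simp
      rw [h2, eq_div h hy] at h1
      unfold Uq
      linear_combination h1)
  have fin : ∀ {B y : ℝ}, y ∈ II → |Fq u y| ≤ B → |Uq u y| ≤ B * (1 - y ^ 2) → Nq u y ≤ 2 * B ^ 2 := by
    intro B y hy h1 h2
    have h3 := s2_pos hy
    have hB := (abs_nonneg _).trans h1
    rw [hNe y hy]
    have k1 : Fq u y ^ 2 ≤ B ^ 2 := by rw [← sq_abs]; gcongr
    have k2 : Uq u y ^ 2 / (1 - y ^ 2) ≤ B ^ 2 := by
      rw [div_le_iff₀ h3, ← sq_abs]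
      calc |Uq u y| ^ 2 ≤ (B * (1 - y ^ 2)) ^ 2 := by gcongr
        _ = B ^ 2 * (1 - y ^ 2) * (1 - y ^ 2) := by ring
        _ ≤ B ^ 2 * (1 - y ^ 2) * 1 := by gcongr; nlinarith [sq_nonneg y]
        _ = _ := by ring
    linarith
  rcases he with rfl | rfl
  · -- singular at the north pole: reflect
    rw [nIIm1] at *
    rw [nII1] at *
    have tl : Tendsto (fun y : ℝ => -y) (𝓝[>] (-1)) (𝓝[<] 1) := by
      simpa using tendsto_neg_nhdsGT (a := (-1:ℝ))
    have tr : Tendsto (fun y : ℝ => -y) (𝓝[<] 1) (𝓝[>] (-1)) := tendsto_neg_nhdsLT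
    have hmem : ∀ y ∈ II, -y ∈ II := fun y hy => ⟨by linarith [hy.2], by linarith [hy.1]⟩
    obtain ⟨B, hB⟩ := end_analysis (U := fun y => - Uq u (-y)) (F := fun y => Fq u (-y))
      (a := a) (b := -b) (c := c) (M := M) (K := K)
      (fun y hy => by
        have := ((U_der h (hmem y hy)).comp y (hasDerivAt_neg y)).neg
        exact this.congr_deriv (by ring))
      (fun y hy => by have := hq (-y) (hmem y hy); linear_combination this)
      (by simpa using (a1.comp tl).neg) (by simpa using (b1.comp tr).neg)
      (by simpa [Function.comp_def] using a3.comp tl)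
      (tr.eventually hF') (by simpa using tl.eventually a4)
    refine ⟨2 * B ^ 2, ?_⟩
    have := tr.eventually hB
    filter_upwards [this, hI] with y h1 h2
    simp only [neg_neg, abs_neg, neg_sq] at h1
    exact fin h2 h1.1 h1.2
  · simp only [neg_neg] at *
    rw [nIIm1] at *
    rw [nII1] at *
    obtain ⟨B, hB⟩ := end_analysis (fun y hy => U_der h hy) hq a1 b1 a3 hF' a4
    refine ⟨2 * B ^ 2, ?_⟩
    filter_upwards [hB, hI] with y h1 h2
    exact fin h2 h1.1 h1.2

end

lemma Off_sub {P : V3} (h0 : P 0 = 0) (h1 : P 1 = 0) : Off ⊆ cone3 (sphere2 \ {P}) := by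
  intro x hx
  have hx0 := Off_ne hx
  have hn : 0 < ‖x‖ := norm_pos_iff.2 hx0
  refine ⟨hx0, ?_, ?_⟩
  · simp only [sphere2, mem_sphere_iff_norm, sub_zero, norm_smul, norm_inv, norm_norm]
    exact inv_mul_cancel₀ hn.ne'
  · intro hP
    have hP : ‖x‖⁻¹ • x = P := hP
    apply hx
    constructor
    · have := congrArg (fun z : V3 => z 0) hP
      simpa [h0, hn.ne', hx0] using this
    · have := congrArg (fun z : V3 => z 1) hP
      simpa [h1, hn.ne', hx0] using this

lemma qv_cont : Continuous qv := by
  unfold qv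
  apply (PiLp.continuous_toLp 2 _).comp
  refine continuous_pi fun i => ?_
  fin_cases i <;> simp <;> fun_prop

lemma qv_end {e : ℝ} (he : e = 1 ∨ e = -1) : qv e = EuclideanSpace.single 2 e := by
  ext i
  fin_cases i <;> rcases he with rfl | rfl <;> simp [qv]

lemma rho_qv {y : ℝ} : rho (qv y) = √(1 - y ^ 2) := by
  unfold rho
  simp only [qv0, qv1]
  rw [zero_pow two_ne_zero, add_zero, Real.sqrt_sq (Real.sqrt_nonneg _)]

lemma sph_rho {x : V3} (hx : ‖x‖ = 1) : rho x = √(1 - x 2 ^ 2) := by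
  have := norm_sq3 x
  unfold rho; congr 1; rw [hx] at this; linarith

lemma main_aux {e : ℝ} (he : e = 1 ∨ e = -1) {u : V3 → V3} {p : V3 → ℝ}
    (h1 : Sol u p) (hc : ContinuousOn u (cone3 (sphere2 \ {EuclideanSpace.single 2 e}))) {C c : ℝ}
    (hC : ∀ᶠ x in 𝓝[sphere2 \ {EuclideanSpace.single 2 e}] (EuclideanSpace.single 2 e : V3),
      ‖u x‖ ≤ C * |Real.log (rho x)|) (hc0 : 0 < c)
    (hf : ∃ᶠ x in 𝓝[sphere2 \ {EuclideanSpace.single 2 e}] (EuclideanSpace.single 2 e : V3),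
      c * |Real.log (rho x)| ≤ ‖u x‖) : False := by
  have he2 : e ^ 2 = 1 := by rcases he with rfl | rfl <;> norm_num
  have hen : e ≠ 0 := by rcases he with rfl | rfl <;> norm_num
  have he' : -e = 1 ∨ -e = -1 := by rcases he with rfl | rfl <;> simp
  set P : V3 := EuclideanSpace.single 2 e with hPdef
  have P0 : P 0 = 0 := by simp [hPdef]
  have P1 : P 1 = 0 := by simp [hPdef]
  have P2 : P 2 = e := by simp [hPdef]
  have hI : ∀ e' : ℝ, ∀ᶠ y in 𝓝[II] e', y ∈ II := fun e' => self_mem_nhdsWithin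
  have hq : Tendsto qv (𝓝[II] e) (𝓝[sphere2 \ {P}] P) := by
    apply tendsto_nhdsWithin_of_tendsto_nhds_of_eventually_within
    · rw [hPdef, ← qv_end he]; exact qv_cont.continuousWithinAt
    · filter_upwards [hI e] with y hy
      refine ⟨by simp [sphere2, qv_norm hy], ?_⟩
      intro h
      have h : qv y = P := h
      apply qv_off hy
      rw [h]; exact ⟨P0, P1⟩
  have hq' : Tendsto (fun y => u (qv y)) (𝓝[II] (-e)) (𝓝 (u (qv (-e)))) := by
    have hm : qv (-e) ∈ cone3 (sphere2 \ {P}) := by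
      have hn : ‖qv (-e)‖ = 1 := by
        rw [qv_end he', EuclideanSpace.norm_single]
        rcases he with rfl | rfl <;> simp
      refine ⟨ne_one hn, ?_⟩
      rw [hn, inv_one, one_smul]
      refine ⟨by simp [sphere2, hn], ?_⟩
      intro h
      have h : qv (-e) = P := h
      have h2 := congrArg (fun z : V3 => z 2) h
      simp only [qv2, P2] at h2
      apply hen; linarith
    refine (hc _ hm).tendsto.comp ?_
    apply tendsto_nhdsWithin_of_tendsto_nhds_of_eventually_within
    · exact qv_cont.continuousWithinAt
    · filter_upwards [hI (-e)] with y hy using Off_sub P0 P1 (qv_off hy)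
  have b1 : ∀ᶠ y in 𝓝[II] e, Nq u y ≤ (2 * |C| * (1 - y ^ 2) ^ (-(1/4) : ℝ)) ^ 2 := by
    filter_upwards [hq.eventually hC, hI e] with y hy hyI
    have h3 := s2_pos hyI
    have hN := normN h1 (qv_off hyI) (qv_norm hyI)
    rw [qv2] at hN
    rw [← hN]
    have hl := Real.abs_log_mul_self_rpow_lt (1 - y ^ 2) (1/4) h3 (by nlinarith) (by norm_num)
    rw [abs_mul, abs_of_pos (Real.rpow_pos_of_pos h3 _)] at hl
    rw [rho_qv, Real.log_sqrt h3.le, abs_div, abs_two] at hy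
    have hr : (1 - y ^ 2) ^ (-(1/4) : ℝ) = ((1 - y ^ 2) ^ (1/4 : ℝ))⁻¹ := Real.rpow_neg h3.le _
    have hp := Real.rpow_pos_of_pos h3 (1/4)
    have hll : |Real.log (1 - y ^ 2)| ≤ 4 * (1 - y ^ 2) ^ (-(1/4) : ℝ) := by
      rw [hr, ← div_eq_mul_inv, le_div_iff₀ hp]; linarith
    have : ‖u (qv y)‖ ≤ 2 * |C| * (1 - y ^ 2) ^ (-(1/4) : ℝ) := by
      calc ‖u (qv y)‖ ≤ C * (|Real.log (1 - y ^ 2)| / 2) := hy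
        _ ≤ |C| * (|Real.log (1 - y ^ 2)| / 2) := by gcongr; exact le_abs_self C
        _ ≤ |C| * (4 * (1 - y ^ 2) ^ (-(1/4) : ℝ) / 2) := by gcongr
        _ = _ := by ring
    gcongr
  have b2 : ∀ᶠ y in 𝓝[II] (-e), Nq u y ≤ (‖u (qv (-e))‖ + 1) ^ 2 := by
    have := hq'.norm.eventually (gt_mem_nhds (lt_add_one _))
    filter_upwards [this, hI (-e)] with y hy hyI
    have hN := normN h1 (qv_off hyI) (qv_norm hyI)
    rw [qv2] at hN
    rw [← hN]
    gcongr
  obtain ⟨B, hB⟩ := core h1 he (by positivity) (by positivity) b1 b2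
  have hcoord : Continuous (fun x : V3 => x 2) := by fun_prop
  have hoff : ∀ᶠ x in 𝓝[sphere2 \ {P}] P, ‖x‖ = 1 ∧ x ∈ Off := by
    have hne : ∀ᶠ x in 𝓝[sphere2 \ {P}] P, x 2 ≠ -e := by
      apply Filter.Eventually.filter_mono nhdsWithin_le_nhds
      apply hcoord.continuousAt.eventually_ne
      rw [P2]; intro h; apply hen; linarith
    filter_upwards [hne, self_mem_nhdsWithin] with x hx hx'
    have hn : ‖x‖ = 1 := by simpa [sphere2] using hx'.1
    refine ⟨hn, ?_⟩
    rintro ⟨h0, h1⟩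
    have hs := norm_sq3 x
    rw [hn, h0, h1] at hs
    have : (x 2 - e) * (x 2 + e) = 0 := by nlinarith
    rcases mul_eq_zero.1 this with h | h
    · apply hx'.2
      show x = P
      ext i
      fin_cases i
      · simpa [P0] using h0
      · simpa [P1] using h1
      · change x 2 = P 2
        rw [P2]; linarith
    · apply hx; linarith
  have ht : Tendsto (fun x : V3 => x 2) (𝓝[sphere2 \ {P}] P) (𝓝[II] e) := by
    apply tendsto_nhdsWithin_of_tendsto_nhds_of_eventually_within
    · rw [← P2]; exact hcoord.continuousWithinAt
    · filter_upwards [hoff] with x hx using x2_mem hx.2 hx.1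
  have hrho : Tendsto rho (𝓝[sphere2 \ {P}] P) (𝓝[>] 0) := by
    apply tendsto_nhdsWithin_of_tendsto_nhds_of_eventually_within
    · have hrc : Continuous rho := by unfold rho; fun_prop
      have := hrc.tendsto P
      have h0 : rho P = 0 := by simp [rho, P0, P1]
      rw [h0] at this
      exact tendsto_nhdsWithin_of_tendsto_nhds this
    · filter_upwards [hoff] with x hx using rho_pos hx.2
  have hlog : Tendsto (fun x => |Real.log (rho x)|) (𝓝[sphere2 \ {P}] P) atTop :=
    tendsto_abs_atBot_atTop.comp (Real.tendsto_log_nhdsGT_zero.comp hrho)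
  have hbig := hlog.eventually_gt_atTop (√|B| / c)
  apply hf
  filter_upwards [hbig, hoff, ht.eventually hB] with x h2 h3 h4
  rw [← normN h1 h3.2 h3.1] at h4
  rw [div_lt_iff₀ hc0] at h2
  have : ‖u x‖ ≤ √|B| := Real.le_sqrt_of_sq_le (h4.trans (le_abs_self B))
  intro h5
  nlinarith

/-- nonexistence of axisymmetric solutions with exactly logarithmic
singularity at a single pole (Lemma 3.1, second part). -/
theorem no_single_pole_log_singularity (P : V3) (hP : P = S3 ∨ P = N3) :
    ¬ ∃ (u : V3 → V3) (p : V3 → ℝ),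
      (∀ x ∈ cone3 (sphere2 \ {P}), ∀ lam : ℝ, 0 < lam → u (lam • x) = lam⁻¹ • u x) ∧
      (∀ x ∈ cone3 (sphere2 \ {P}), ∀ lam : ℝ, 0 < lam → p (lam • x) = (lam ^ 2)⁻¹ * p x) ∧
      ContDiffOn ℝ 2 u (cone3 (sphere2 \ {P})) ∧
      ContDiffOn ℝ 1 p (cone3 (sphere2 \ {P})) ∧
      AxisymOn u (cone3 (sphere2 \ {P})) ∧
      (∀ x ∈ cone3 (sphere2 \ {P}), NSEq u p x) ∧
      (∃ C : ℝ, ∀ᶠ x in 𝓝[sphere2 \ {P}] P, ‖u x‖ ≤ C * |Real.log (rho x)|) ∧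
      (∃ c > (0:ℝ), ∃ᶠ x in 𝓝[sphere2 \ {P}] P, c * |Real.log (rho x)| ≤ ‖u x‖) := by
  rintro ⟨u, p, hu, hp, cu, cp, ax, ns, ⟨C, hC⟩, c, hc, hf⟩
  have he : ∃ e : ℝ, (e = 1 ∨ e = -1) ∧ P = EuclideanSpace.single 2 e := by
    rcases hP with rfl | rfl
    · exact ⟨-1, Or.inr rfl, rfl⟩
    · exact ⟨1, Or.inl rfl, rfl⟩
  obtain ⟨e, he, rfl⟩ := he
  have hs := Off_sub (P := EuclideanSpace.single 2 e) (by simp) (by simp)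
  have h1 : Sol u p := ⟨fun x hx => hu x (hs hx), fun x hx => hp x (hs hx), cu.mono hs,
    cp.mono hs, fun x hx y hy => ax x (hs hx) y (hs hy), fun x hx => ns x (hs hx)⟩
  exact main_aux he h1 cu.continuousOn hC hc hf
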